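/- arXiv:1110.6583 — 6 statements merged into one kernel-verified Lean document; each statement's English description precedes it below -/
import Mathlib

section
/- Let V be a nonzero subspace of the Hilbert space H = H_1 ⊗ … ⊗ H_n of n finite-dimensional quantum systems, and suppose V is the ground-state space (the eigenspace of the minimal eigenvalue) of some K-local Hamiltonian H = Σ_j H_j, where K is an interaction pattern and each H_j acts nontrivially only on the subsystems in some K_i ∈ K. Then V is K-correlated: the maximally mixed state ρ_V = P_V/dim V on V is the unique state of maximal von Neumann entropy among all density matrices σ on H whose reduced density matrices γ_{K_i}(σ) coincide with those of ρ_V for every K_i ∈ K. -/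
open scoped BigOperators ComplexOrder

namespace Paper

/-- The index set of the computational basis of an `n`-partite Hilbert space
`H = H_1 ⊗ ⋯ ⊗ H_n` with `dim H_i = d i`. -/
abbrev Idx {n : ℕ} (d : Fin n → ℕ) : Type := ∀ i : Fin n, Fin (d i)

/-- The index set for the subsystems in `K ⊆ {1,…,n}`. -/
abbrev SubIdx {n : ℕ} (d : Fin n → ℕ) (K : Finset (Fin n)) : Type :=
  ∀ i : {j : Fin n // j ∈ K}, Fin (d i.1)

/-- The index set for the subsystems outside `K`. -/
abbrev CoIdx {n : ℕ} (d : Fin n → ℕ) (K : Finset (Fin n)) : Type :=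
  ∀ i : {j : Fin n // j ∉ K}, Fin (d i.1)

/-- Glue an index on `K` and an index on the complement of `K` to a full index. -/
def merge {n : ℕ} {d : Fin n → ℕ} (K : Finset (Fin n)) (a : SubIdx d K) (c : CoIdx d K) :
    Idx d := fun i => if h : i ∈ K then a ⟨i, h⟩ else c ⟨i, h⟩

/-- A density matrix: positive semidefinite with trace one. -/
def IsDensityMatrix {m : Type*} [Fintype m] (ρ : Matrix m m ℂ) : Prop :=
  ρ.PosSemidef ∧ ρ.trace = 1

/-- The reduced density matrix `γ_K(ρ)`: the partial trace of `ρ` over all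
subsystems outside `K`. -/
noncomputable def rdm {n : ℕ} {d : Fin n → ℕ} (K : Finset (Fin n))
    (ρ : Matrix (Idx d) (Idx d) ℂ) : Matrix (SubIdx d K) (SubIdx d K) ℂ :=
  fun a b => ∑ c : CoIdx d K, ρ (merge K a c) (merge K b c)

/-- The von Neumann entropy `S(ρ) = -Tr(ρ log ρ)`, computed through the eigenvalues. -/
noncomputable def entropy {m : Type*} [Fintype m] [DecidableEq m] (ρ : Matrix m m ℂ) : ℝ :=
  if h : ρ.IsHermitian then ∑ i, Real.negMulLog (h.eigenvalues i) else 0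

/-- `P` is the orthogonal projection (w.r.t. the standard inner product) onto `V`. -/
def IsProjectionOnto {m : Type*} [Fintype m] [DecidableEq m] (P : Matrix m m ℂ)
    (V : Submodule ℂ (m → ℂ)) : Prop :=
  P.IsHermitian ∧ P * P = P ∧ LinearMap.range P.mulVecLin = V

/-- The maximally mixed state `ρ_V = P_V / dim V` on `V`, expressed through a
projection `P` onto `V`. -/
noncomputable def mmix {m : Type*} [Fintype m] [DecidableEq m] (V : Submodule ℂ (m → ℂ))
    (P : Matrix m m ℂ) : Matrix m m ℂ :=
  ((Module.finrank ℂ V : ℂ))⁻¹ • P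

/-- A subspace `V` is `𝒦`-correlated if the maximally mixed state `ρ_V` on `V` is the
unique state of maximal von Neumann entropy among all states having the same
reduced density matrices `γ_K`, `K ∈ 𝒦`, as `ρ_V`. -/
def KCorrelated {n : ℕ} {d : Fin n → ℕ} (𝒦 : Finset (Finset (Fin n)))
    (V : Submodule ℂ (Idx d → ℂ)) : Prop :=
  ∃ P : Matrix (Idx d) (Idx d) ℂ, IsProjectionOnto P V ∧
    IsDensityMatrix (mmix V P) ∧
    ∀ σ : Matrix (Idx d) (Idx d) ℂ, IsDensityMatrix σ →
      (∀ K ∈ 𝒦, rdm K σ = rdm K (mmix V P)) → σ ≠ mmix V P →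
      entropy σ < entropy (mmix V P)

/-- `V` is the eigenspace of `H` for the eigenvalue `E`, and `E` is minimal
(`H - E•1` is positive semidefinite); i.e. `V` is the ground-state space of `H`
with ground energy `E`. -/
def IsGroundStateSpace {m : Type*} [Fintype m] [DecidableEq m] (H : Matrix m m ℂ) (E : ℝ)
    (V : Submodule ℂ (m → ℂ)) : Prop :=
  (H - (E : ℂ) • 1).PosSemidef ∧ ∀ v : m → ℂ, v ∈ V ↔ H.mulVec v = (E : ℂ) • v

/-- Restriction of a full index to the subsystems in `K`. -/
def restrict {n : ℕ} {d : Fin n → ℕ} (K : Finset (Fin n)) (x : Idx d) : SubIdx d K :=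
  fun i => x i.1

/-- Restriction of a full index to the subsystems outside `K`. -/
def corestrict {n : ℕ} {d : Fin n → ℕ} (K : Finset (Fin n)) (x : Idx d) : CoIdx d K :=
  fun i => x i.1

/-- The operator `B ⊗ I`: an operator `B` on the subsystems in `K`, tensored with the
identity on all other subsystems. -/
noncomputable def embed {n : ℕ} {d : Fin n → ℕ} (K : Finset (Fin n))
    (B : Matrix (SubIdx d K) (SubIdx d K) ℂ) : Matrix (Idx d) (Idx d) ℂ :=
  fun x y => if corestrict K x = corestrict K y then B (restrict K x) (restrict K y) else 0

/-- `A` acts nontrivially only on the subsystems in `K`. -/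
def ActsOn {n : ℕ} {d : Fin n → ℕ} (K : Finset (Fin n)) (A : Matrix (Idx d) (Idx d) ℂ) :
    Prop := ∃ B, A = embed K B

/-- `H` is `𝒦`-local: a sum of Hermitian terms, each acting nontrivially only on the
subsystems in some `K ∈ 𝒦`. -/
def IsKLocal {n : ℕ} {d : Fin n → ℕ} (𝒦 : Finset (Finset (Fin n)))
    (H : Matrix (Idx d) (Idx d) ℂ) : Prop :=
  ∃ (M : ℕ) (T : Fin M → Matrix (Idx d) (Idx d) ℂ),
    H = ∑ j, T j ∧ ∀ j, (T j).IsHermitian ∧ ∃ K ∈ 𝒦, ActsOn K (T j)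

/-- The subspace `S ⊗ (full space of the complement of K)` of the full Hilbert space. -/
noncomputable def liftSpace {n : ℕ} {d : Fin n → ℕ} (K : Finset (Fin n))
    (S : Submodule ℂ (SubIdx d K → ℂ)) : Submodule ℂ (Idx d → ℂ) where
  carrier := {x | ∀ c : CoIdx d K, (fun a => x (merge K a c)) ∈ S}
  zero_mem' := fun _ => S.zero_mem
  add_mem' := fun hx hy c => S.add_mem (hx c) (hy c)
  smul_mem' := fun t _ hx c => S.smul_mem t (hx c)


/-- The basis state `|v⟩`. -/
def ket {m : Type*} [DecidableEq m] (v : m) : m → ℂ := fun x => if x = v then 1 else 0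

/-- The pure-state density matrix `|ψ⟩⟨ψ|`. -/
def pureDM {m : Type*} (ψ : m → ℂ) : Matrix m m ℂ := Matrix.vecMulVec ψ (star ψ)

/-- `𝒦`-correlatedness for an interaction pattern given as a tuple `(K_1, …, K_M)`. -/
def KCorrelatedT {n : ℕ} {d : Fin n → ℕ} {M : ℕ} (K : Fin M → Finset (Fin n))
    (V : Submodule ℂ (Idx d → ℂ)) : Prop :=
  ∃ P : Matrix (Idx d) (Idx d) ℂ, IsProjectionOnto P V ∧
    IsDensityMatrix (mmix V P) ∧
    ∀ σ : Matrix (Idx d) (Idx d) ℂ, IsDensityMatrix σ →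
      (∀ j : Fin M, rdm (K j) σ = rdm (K j) (mmix V P)) → σ ≠ mmix V P →
      entropy σ < entropy (mmix V P)


section Aux

open Matrix

theorem trace_embed_mul {n : ℕ} {d : Fin n → ℕ} (K : Finset (Fin n))
    (B : Matrix (SubIdx d K) (SubIdx d K) ℂ) (σ : Matrix (Idx d) (Idx d) ℂ) :
    (embed K B * σ).trace = (B * rdm K σ).trace := by
  have hm : ∀ f : Idx d → ℂ, ∑ x, f x = ∑ a : SubIdx d K, ∑ c : CoIdx d K, f (merge K a c) := by
    intro f
    rw [← Fintype.sum_prod_type' (f := fun a c => f (merge K a c))]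
    refine Fintype.sum_equiv (Equiv.piEquivPiSubtypeProd (· ∈ K) (fun i => Fin (d i))) _ _ ?_
    intro x
    congr 1
    funext i
    simp [merge, Equiv.piEquivPiSubtypeProd]
  have hr : ∀ (a : SubIdx d K) (c : CoIdx d K), restrict K (merge K a c) = a := by
    intro a c
    funext i
    simp [restrict, merge, i.2]
  have hc : ∀ (a : SubIdx d K) (c : CoIdx d K), corestrict K (merge K a c) = c := by
    intro a c
    funext i
    simp [corestrict, merge, i.2]
  simp only [Matrix.trace, Matrix.diag_apply, Matrix.mul_apply, hm, embed, hr, hc, rdm, ite_mul,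
    zero_mul, Finset.sum_ite_eq, Finset.mem_univ, if_true, Finset.mul_sum]
  refine Finset.sum_congr rfl fun a _ => ?_
  rw [Finset.sum_comm]

variable {m : Type*} [Fintype m] [DecidableEq m]

theorem herm_sq_iff {A : Matrix m m ℂ} (hA : A.IsHermitian) (c : ℝ) :
    A * A = (c : ℂ) • A ↔ ∀ i, hA.eigenvalues i * hA.eigenvalues i = c * hA.eigenvalues i := by
  have h := hA.spectral_theorem
  generalize Unitary.conjStarAlgAut ℂ _ hA.eigenvectorUnitary = φ at h
  have h1 : A * A = φ (diagonal (fun i => ((hA.eigenvalues i * hA.eigenvalues i : ℝ) : ℂ))) := by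
    conv_lhs => rw [h]
    rw [← map_mul, diagonal_mul_diagonal]
    simp
  have h2 : (c : ℂ) • A = φ (diagonal (fun i => ((c * hA.eigenvalues i : ℝ) : ℂ))) := by
    conv_lhs => rw [h]
    rw [← map_smul, ← diagonal_smul]
    congr 2
    funext i
    simp
  rw [h1, h2, (EquivLike.injective φ).eq_iff, diagonal_injective.eq_iff, funext_iff]
  simp only [Complex.ofReal_inj]

theorem exists_kernel_proj {A : Matrix m m ℂ} (hA : A.IsHermitian) :
    ∃ P B : Matrix m m ℂ, P.IsHermitian ∧ P * P = P ∧ A * P = 0 ∧ P = 1 - B * A := by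
  have h := hA.spectral_theorem
  generalize Unitary.conjStarAlgAut ℂ _ hA.eigenvectorUnitary = φ at h
  generalize hA.eigenvalues = l at h
  refine ⟨φ (diagonal fun i => if l i = 0 then 1 else 0),
    φ (diagonal fun i => ((l i)⁻¹ : ℂ)), ?_, ?_, ?_, ?_⟩
  · rw [Matrix.IsHermitian, ← star_eq_conjTranspose, ← map_star]
    congr 1
    rw [star_eq_conjTranspose, diagonal_conjTranspose]
    congr 1
    funext i
    simp [apply_ite]
  · rw [← map_mul, diagonal_mul_diagonal]
    congr 2
    funext i
    simp
  · conv_lhs => rw [h]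
    rw [← map_mul, diagonal_mul_diagonal, ← map_zero φ, ← diagonal_zero]
    congr 2
    funext i
    simp
  · conv_rhs => rw [h]
    rw [← map_mul, diagonal_mul_diagonal, ← map_one φ, ← map_sub, ← diagonal_one, diagonal_sub]
    congr 2
    funext i
    by_cases h0 : l i = 0 <;> simp [h0]

theorem psd_mul_eq_zero {A σ : Matrix m m ℂ} (hA : A.PosSemidef) (hσ : σ.PosSemidef)
    (h : (A * σ).trace = 0) : A * σ = 0 := by
  open scoped MatrixOrder in
  obtain ⟨C, hC⟩ := CStarAlgebra.nonneg_iff_eq_star_mul_self.mp hA.nonneg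
  obtain ⟨D, hD⟩ := CStarAlgebra.nonneg_iff_eq_star_mul_self.mp hσ.nonneg
  rw [star_eq_conjTranspose] at hC hD
  have h1 : ((C * Dᴴ)ᴴ * (C * Dᴴ)).trace = 0 := by
    rw [← h, hC, hD, conjTranspose_mul, conjTranspose_conjTranspose]
    rw [show D * Cᴴ * (C * Dᴴ) = D * (Cᴴ * C * Dᴴ) by simp only [Matrix.mul_assoc],
      trace_mul_comm]
    simp only [Matrix.mul_assoc]
  rw [trace_conjTranspose_mul_self_eq_zero_iff] at h1
  rw [hC, hD, show Cᴴ * C * (Dᴴ * D) = Cᴴ * ((C * Dᴴ) * D) by simp only [Matrix.mul_assoc], h1]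
  simp

theorem negMulLog_le (r x : ℝ) (hr : 0 < r) (hx : 0 < x) :
    Real.negMulLog x ≤ x * Real.log r + r⁻¹ - x ∧
    (x ≠ r⁻¹ → Real.negMulLog x < x * Real.log r + r⁻¹ - x) := by
  have e : Real.log (r * x)⁻¹ = - Real.log r - Real.log x := by
    rw [Real.log_inv, Real.log_mul hr.ne' hx.ne']; ring
  have e2 : x * (r * x)⁻¹ = r⁻¹ := by field_simp
  have hp : 0 < (r * x)⁻¹ := by positivity
  constructor
  · have := mul_le_mul_of_nonneg_left (Real.log_le_sub_one_of_pos hp) hx.le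
    rw [e, mul_sub x _ 1, e2] at this
    rw [Real.negMulLog]; linarith
  · intro hne
    have h1 : (r * x)⁻¹ ≠ 1 := by
      intro h
      apply hne
      rw [← e2, h, mul_one]
    have := mul_lt_mul_of_pos_left (Real.log_lt_sub_one_of_pos hp h1) hx
    rw [e, mul_sub x _ 1, e2] at this
    rw [Real.negMulLog]; linarith

theorem sum_eig {σ : Matrix m m ℂ} (h : σ.IsHermitian) (ht : σ.trace = 1) :
    ∑ i, h.eigenvalues i = 1 := by
  rw [h.trace_eq_sum_eigenvalues] at ht
  have h2 := congrArg Complex.re ht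
  simpa using h2

theorem entropy_flat {σ : Matrix m m ℂ} (h : σ.IsHermitian) (ht : σ.trace = 1) (r : ℝ)
    (hs : σ * σ = ((r⁻¹ : ℝ) : ℂ) • σ) : entropy σ = Real.log r := by
  rw [entropy, dif_pos h]
  have h1 := (herm_sq_iff h _).mp hs
  have h2 : ∀ i, Real.negMulLog (h.eigenvalues i) = h.eigenvalues i * Real.log r := by
    intro i
    by_cases h0 : h.eigenvalues i = 0
    · simp [h0]
    · rw [mul_right_cancel₀ h0 (h1 i), Real.negMulLog, Real.log_inv]; ring
  simp only [h2]
  rw [← Finset.sum_mul, sum_eig h ht, one_mul]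

theorem entropy_lt {σ : Matrix m m ℂ} (h : σ.PosSemidef) (ht : σ.trace = 1) (r : ℕ) (hr : 0 < r)
    (hrk : σ.rank ≤ r) (hs : σ * σ ≠ (((r : ℝ)⁻¹ : ℝ) : ℂ) • σ) : entropy σ < Real.log r := by
  have hr' : (0 : ℝ) < r := by exact_mod_cast hr
  have hh := h.isHermitian
  rw [entropy, dif_pos hh]
  rw [Ne, herm_sq_iff hh] at hs
  push Not at hs
  obtain ⟨j, hj⟩ := hs
  set l := hh.eigenvalues with hl
  have hnn : ∀ i, 0 ≤ l i := h.eigenvalues_nonneg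
  have hjj : l j ≠ 0 := by
    intro h0; apply hj; simp [h0]
  have hjr : l j ≠ (r : ℝ)⁻¹ := by
    intro h0; apply hj; rw [h0]
  have hlt : ∑ i, Real.negMulLog (l i) <
      ∑ i, (l i * Real.log r + (if l i ≠ 0 then (r : ℝ)⁻¹ else 0) - l i) := by
    apply Finset.sum_lt_sum
    · intro i _
      by_cases h0 : l i = 0
      · simp [h0]
      · simpa [h0] using (negMulLog_le r (l i) hr' (lt_of_le_of_ne (hnn i) (Ne.symm h0))).1
    · exact ⟨j, Finset.mem_univ _, by
        simpa [hjj] using (negMulLog_le r (l j) hr' (lt_of_le_of_ne (hnn j) (Ne.symm hjj))).2 hjr⟩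
  refine hlt.trans_le ?_
  rw [hh.rank_eq_card_non_zero_eigs, Fintype.card_subtype] at hrk
  have hc : ∑ i, (if l i ≠ 0 then (r : ℝ)⁻¹ else 0) ≤ 1 := by
    rw [← Finset.sum_filter, Finset.sum_const, nsmul_eq_mul, ← div_eq_mul_inv, div_le_one hr']
    exact_mod_cast hrk
  rw [Finset.sum_sub_distrib, Finset.sum_add_distrib, ← Finset.sum_mul, sum_eig hh ht]
  linarith

end Aux

/-- If a nonzero subspace `V` is the ground-state space of some
`𝒦`-local Hamiltonian, then `V` is `𝒦`-correlated. -/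
theorem groundStateSpace_isKCorrelated {n : ℕ} {d : Fin n → ℕ}
    (𝒦 : Finset (Finset (Fin n))) (H : Matrix (Idx d) (Idx d) ℂ) (E : ℝ)
    (V : Submodule ℂ (Idx d → ℂ)) (hV : V ≠ ⊥)
    (hloc : IsKLocal 𝒦 H) (hgs : IsGroundStateSpace H E V) :
    KCorrelated 𝒦 V := by
  obtain ⟨hpsd, hmem⟩ := hgs
  set A := H - (E : ℂ) • (1 : Matrix (Idx d) (Idx d) ℂ) with hAdef
  obtain ⟨P, B, hPh, hPP, hAP, hPB⟩ := exists_kernel_proj hpsd.isHermitian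
  have hker : ∀ v, v ∈ V ↔ A.mulVec v = 0 := by
    intro v
    rw [hmem, hAdef, Matrix.sub_mulVec, Matrix.smul_mulVec, Matrix.one_mulVec, sub_eq_zero]
  have hfix : ∀ v ∈ V, P.mulVec v = v := by
    intro v hv
    rw [hPB, Matrix.sub_mulVec, Matrix.one_mulVec, ← Matrix.mulVec_mulVec, (hker v).mp hv,
      Matrix.mulVec_zero, sub_zero]
  have hin : ∀ v, P.mulVec v ∈ V := by
    intro v
    rw [hker, Matrix.mulVec_mulVec, hAP, Matrix.zero_mulVec]
  have hrange : LinearMap.range P.mulVecLin = V := by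
    ext v
    constructor
    · rintro ⟨w, rfl⟩
      exact hin w
    · intro hv
      exact ⟨v, hfix v hv⟩
  set r := Module.finrank ℂ V with hrdef
  have hr : 0 < r := by
    rw [hrdef, Nat.pos_iff_ne_zero, Ne, Submodule.finrank_eq_zero]
    exact hV
  have hrC : (r : ℂ) ≠ 0 := by exact_mod_cast hr.ne'
  have hPtr : P.trace = r := by
    have hp : LinearMap.IsProj V (Matrix.toLin' P) := ⟨fun v => hin v, fun v hv => hfix v hv⟩
    have := hp.trace
    rwa [Matrix.trace_toLin'_eq] at this
  have hPrk : P.rank = r := by rw [Matrix.rank, hrange]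
  have hPpsd : P.PosSemidef := by
    have := Matrix.posSemidef_conjTranspose_mul_self P
    rwa [hPh.eq, hPP] at this
  have hρdef : mmix V P = (r : ℂ)⁻¹ • P := rfl
  have hρtr : (mmix V P).trace = 1 := by
    rw [hρdef, Matrix.trace_smul, hPtr, smul_eq_mul, inv_mul_cancel₀ hrC]
  have hρpsd : (mmix V P).PosSemidef := by
    rw [hρdef]
    apply hPpsd.smul
    rw [← Complex.ofReal_natCast, ← Complex.ofReal_inv]
    exact_mod_cast (by positivity : (0 : ℝ) ≤ (r : ℝ)⁻¹)
  have hρsq : mmix V P * mmix V P = (((r : ℝ)⁻¹ : ℝ) : ℂ) • mmix V P := by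
    rw [hρdef, Matrix.smul_mul, Matrix.mul_smul, hPP]
    simp
  refine ⟨P, ⟨hPh, hPP, hrange⟩, ⟨hρpsd, hρtr⟩, ?_⟩
  intro σ ⟨hσ, hσtr⟩ hrdm hne
  rw [entropy_flat hρpsd.isHermitian hρtr r hρsq]
  have hHtr : (H * σ).trace = (H * mmix V P).trace := by
    obtain ⟨M, T, hH, hT⟩ := hloc
    rw [hH, Finset.sum_mul, Finset.sum_mul, Matrix.trace_sum, Matrix.trace_sum]
    refine Finset.sum_congr rfl fun j _ => ?_
    obtain ⟨-, K, hK, C, hC⟩ := hT j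
    rw [hC, trace_embed_mul, trace_embed_mul, hrdm K hK]
  have hAtr : (A * σ).trace = 0 := by
    have h1 : (A * mmix V P).trace = 0 := by
      rw [hρdef, Matrix.mul_smul, hAP, smul_zero, Matrix.trace_zero]
    rw [← h1, hAdef, Matrix.sub_mul, Matrix.sub_mul, Matrix.trace_sub, Matrix.trace_sub, hHtr]
    simp [hσtr, hρtr]
  have hAσ := psd_mul_eq_zero hpsd hσ hAtr
  have hPσ : P * σ = σ := by
    rw [hPB, Matrix.sub_mul, Matrix.one_mul, Matrix.mul_assoc, hAσ, Matrix.mul_zero, sub_zero]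
  have hσP : σ * P = σ := by
    have := congrArg Matrix.conjTranspose hPσ
    rwa [Matrix.conjTranspose_mul, hσ.isHermitian.eq, hPh.eq] at this
  apply entropy_lt hσ hσtr r hr
  · rw [← hPσ, ← hPrk]
    exact Matrix.rank_mul_le_left P σ
  · intro hsq
    apply hne
    have h0 : (σ - mmix V P) = 0 := by
      rw [← Matrix.trace_conjTranspose_mul_self_eq_zero_iff, Matrix.conjTranspose_sub,
        hσ.isHermitian.eq, hρpsd.isHermitian.eq, Matrix.sub_mul, Matrix.mul_sub, Matrix.mul_sub,
        hsq, hρsq, hρdef, Matrix.smul_mul, Matrix.mul_smul, hPσ, hσP]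
      simp [Matrix.trace_sub, Matrix.trace_smul, hσtr, hPtr, hrC]
    exact sub_eq_zero.mp h0

end Paper
end

section
/- Let K be an interaction pattern on an n-partite finite-dimensional Hilbert space H, and let V be a K-correlated subspace of H. Then for every density matrix ρ with range(ρ) ⊆ V and every density matrix σ satisfying γ_{K_i}(σ) = γ_{K_i}(ρ) for all K_i ∈ K, one has range(σ) ⊆ V. -/
open scoped BigOperators ComplexOrder

namespace Paper

section Helpers
open Matrix

variable {m : Type*} [Fintype m] [DecidableEq m]

lemma trace_sq_eq (A : Matrix m m ℂ) (h : A.IsHermitian) :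
    (A * A).trace = ((∑ i, h.eigenvalues i ^ 2 : ℝ) : ℂ) := by
  have key : A * A = (h.eigenvectorUnitary : Matrix m m ℂ) *
      (diagonal (fun i => ((h.eigenvalues i ^ 2 : ℝ) : ℂ))) *
      (star (h.eigenvectorUnitary : Matrix m m ℂ)) := by
    have hs := h.spectral_theorem
    rw [Unitary.conjStarAlgAut_apply] at hs
    have hu : star (h.eigenvectorUnitary : Matrix m m ℂ) * (h.eigenvectorUnitary : Matrix m m ℂ) = 1 :=
      Unitary.coe_star_mul_self _
    conv_lhs => rw [hs]
    generalize (h.eigenvectorUnitary : Matrix m m ℂ) = U at *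
    calc _ = U * (diagonal (RCLike.ofReal ∘ h.eigenvalues) * (star U * U) *
          diagonal (RCLike.ofReal ∘ h.eigenvalues)) * star U := by
            simp only [Matrix.mul_assoc]
      _ = _ := by
        rw [hu, Matrix.mul_one, diagonal_mul_diagonal]
        congr 3
        ext i
        simp [pow_two]
  rw [key, Matrix.trace_mul_comm, ← Matrix.mul_assoc]
  have hu : star (h.eigenvectorUnitary : Matrix m m ℂ) * (h.eigenvectorUnitary : Matrix m m ℂ) = 1 :=
      Unitary.coe_star_mul_self _
  rw [hu, Matrix.one_mul, trace_diagonal]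
  push_cast
  rfl

lemma sum_eig_s1 (A : Matrix m m ℂ) (h : IsDensityMatrix A) :
    ∑ i, h.1.1.eigenvalues i = 1 := by
  have := h.1.1.trace_eq_sum_eigenvalues
  have h3 := h.2
  have h2 : ((∑ i, h.1.1.eigenvalues i : ℝ) : ℂ) = 1 := by
    refine Eq.trans ?_ (this.symm.trans h3)
    push_cast; rfl
  exact_mod_cast h2

lemma one_sub_posSemidef (A : Matrix m m ℂ) (h : IsDensityMatrix A) :
    (1 - A).PosSemidef := by
  have hs := h.1.1.spectral_theorem
  rw [Unitary.conjStarAlgAut_apply] at hs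
  have hu : (h.1.1.eigenvectorUnitary : Matrix m m ℂ) * star (h.1.1.eigenvectorUnitary : Matrix m m ℂ) = 1 :=
      Unitary.coe_mul_star_self _
  have key : 1 - A = (h.1.1.eigenvectorUnitary : Matrix m m ℂ) *
      (diagonal (fun i => ((1 - h.1.1.eigenvalues i : ℝ) : ℂ))) *
      (h.1.1.eigenvectorUnitary : Matrix m m ℂ)ᴴ := by
    have hd : diagonal (fun i => ((1 - h.1.1.eigenvalues i : ℝ) : ℂ)) =
        1 - diagonal (RCLike.ofReal ∘ h.1.1.eigenvalues) := by
      rw [← diagonal_one, diagonal_sub]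
      congr 1
      ext i
      simp
    rw [hd, Matrix.mul_sub, Matrix.sub_mul, Matrix.mul_one, ← star_eq_conjTranspose, hu, ← hs]
  rw [key]
  apply PosSemidef.mul_mul_conjTranspose_same
  apply PosSemidef.diagonal
  intro i
  have h1 : h.1.1.eigenvalues i ≤ 1 := by
    rw [← sum_eig_s1 A h]
    exact Finset.single_le_sum (f := h.1.1.eigenvalues) (fun j _ => h.1.eigenvalues_nonneg j)
      (Finset.mem_univ i)
  have h2 : 0 ≤ 1 - h.1.1.eigenvalues i := by linarith
  show (0 : ℂ) ≤ ((1 - h.1.1.eigenvalues i : ℝ) : ℂ)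
  exact_mod_cast h2

lemma entropy_lower (A : Matrix m m ℂ) (h : IsDensityMatrix A) (D : ℝ) (hD : 0 < D)
    (hA : D * (A * A).trace.re ≤ 1) : Real.log D ≤ entropy A := by
  unfold entropy
  rw [dif_pos h.1.1]
  rw [trace_sq_eq A h.1.1, Complex.ofReal_re] at hA
  have hb : ∀ i, h.1.1.eigenvalues i * (Real.log D + 1) - D * h.1.1.eigenvalues i ^ 2
      ≤ Real.negMulLog (h.1.1.eigenvalues i) := by
    intro i
    have h0 := h.1.eigenvalues_nonneg i
    generalize h.1.1.eigenvalues i = x at *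
    rcases h0.eq_or_lt with h0 | h0
    · rw [← h0]; simp
    · have := Real.log_le_sub_one_of_pos (mul_pos hD h0)
      rw [Real.log_mul hD.ne' h0.ne'] at this
      unfold Real.negMulLog
      nlinarith
  have := Finset.sum_le_sum (s := Finset.univ) (fun i _ => hb i)
  rw [Finset.sum_sub_distrib, ← Finset.sum_mul, ← Finset.mul_sum, sum_eig_s1 A h] at this
  linarith

lemma entropy_flat_s1 (A : Matrix m m ℂ) (h : IsDensityMatrix A) (D : ℝ) (hD : 0 < D)
    (hA : A * A = ((D : ℂ))⁻¹ • A) : entropy A = Real.log D := by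
  unfold entropy
  rw [dif_pos h.1.1]
  have hb : ∀ i, Real.negMulLog (h.1.1.eigenvalues i) = h.1.1.eigenvalues i * Real.log D := by
    intro i
    have hv := h.1.1.mulVec_eigenvectorBasis i
    have hne : (WithLp.ofLp (h.1.1.eigenvectorBasis i)) ≠ 0 := by
      intro h0
      have := h.1.1.eigenvectorBasis.orthonormal.ne_zero i
      apply this
      ext j
      exact congrFun h0 j
    generalize h.1.1.eigenvalues i = x at *
    generalize WithLp.ofLp (h.1.1.eigenvectorBasis i) = v at *
    have e1 : (A * A) *ᵥ v = (x * x) • v := by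
      rw [← mulVec_mulVec, hv, mulVec_smul, hv, smul_smul]
    rw [hA, smul_mulVec, hv] at e1
    obtain ⟨j, hj⟩ := Function.ne_iff.mp hne
    have e2 := congrFun e1 j
    simp only [Pi.smul_apply, Pi.zero_apply, Complex.real_smul, smul_eq_mul] at e2 hj
    have e3 : ((D⁻¹ * x : ℝ) : ℂ) = ((x * x : ℝ) : ℂ) := by
      apply mul_right_cancel₀ hj
      rw [← e2]; push_cast; ring
    have e4 : D⁻¹ * x = x * x := by exact_mod_cast e3
    by_cases hx : x = 0
    · simp [hx]
    · have : x = D⁻¹ := (mul_right_cancel₀ hx e4).symm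
      rw [this, Real.negMulLog, Real.log_inv]; ring
  rw [Finset.sum_congr rfl (fun i _ => hb i), ← Finset.sum_mul, sum_eig_s1 A h, one_mul]

lemma proj_mul_of_range {V : Submodule ℂ (m → ℂ)} {P ρ : Matrix m m ℂ}
    (hP : IsProjectionOnto P V) (h : LinearMap.range ρ.mulVecLin ≤ V) : P * ρ = ρ := by
  apply Matrix.toLin'.injective
  ext1 j
  ext1
  simp only [LinearMap.comp_apply, toLin'_apply]
  have hm : ρ *ᵥ (LinearMap.single ℂ (fun _ => ℂ) j 1) ∈ V := h ⟨_, rfl⟩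
  rw [← hP.2.2] at hm
  obtain ⟨w, hw⟩ := hm
  rw [mulVecLin_apply] at hw
  rw [← mulVec_mulVec, ← hw, mulVec_mulVec, hP.2.1]

lemma support_of_trace {P σ : Matrix m m ℂ} (hPh : P.IsHermitian) (hPP : P * P = P)
    (hσ : σ.PosSemidef) (h : ((1 - P) * σ).trace = 0) : P * σ = σ := by
  have hQh : (1 - P)ᴴ = 1 - P := by
    rw [conjTranspose_sub, conjTranspose_one, hPh.eq]
  have hQQ : (1 - P) * (1 - P) = 1 - P := by
    rw [Matrix.mul_sub, Matrix.sub_mul, Matrix.sub_mul, hPP]; simp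
  have h1 : ((1 - P) * σ * (1 - P)ᴴ).PosSemidef := hσ.mul_mul_conjTranspose_same _
  have h2 : ((1 - P) * σ * (1 - P)ᴴ).trace = 0 := by
    rw [Matrix.trace_mul_comm, hQh, ← Matrix.mul_assoc, hQQ, h]
  have h3 := h1.trace_eq_zero_iff.mp h2
  have h4 : σ * (1 - P) = 0 := by
    apply Matrix.toLin'.injective
    apply LinearMap.ext
    intro v
    rw [toLin'_apply, map_zero, LinearMap.zero_apply, ← mulVec_mulVec]
    rw [← hσ.dotProduct_mulVec_zero_iff, star_mulVec, ← dotProduct_mulVec, mulVec_mulVec,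
      mulVec_mulVec]
    rw [hQh] at h3 ⊢
    rw [h3]
    simp
  have h5 := congrArg conjTranspose h4
  rw [conjTranspose_mul, hQh, hσ.1.eq, conjTranspose_zero, Matrix.sub_mul, Matrix.one_mul] at h5
  exact (sub_eq_zero.mp h5).symm

lemma trace_mul_self_real {A B : Matrix m m ℂ} (hA : A.IsHermitian) (hB : B.IsHermitian) :
    (A * B).trace = ((A * B).trace.re : ℂ) := by
  have : star (A * B).trace = (A * B).trace := by
    rw [← trace_conjTranspose, conjTranspose_mul, hA.eq, hB.eq, trace_mul_comm]
  exact (Complex.conj_eq_iff_re.mp this).symm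

end Helpers

lemma rdm_perturb {n : ℕ} {d : Fin n → ℕ} (K : Finset (Fin n))
    (A ρ σ : Matrix (Idx d) (Idx d) ℂ) (c : ℂ) (h : rdm K σ = rdm K ρ) :
    rdm K (A + c • (σ - ρ)) = rdm K A := by
  ext a b
  have := congrFun (congrFun h a) b
  simp only [rdm] at this ⊢
  simp only [Matrix.add_apply, Matrix.smul_apply, Matrix.sub_apply, smul_eq_mul,
    Finset.sum_add_distrib, ← Finset.mul_sum, Finset.sum_sub_distrib, this]
  simp

/-- If `V` is `𝒦`-correlated, `ρ` is a density matrix supported on `V`,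
and `σ` is a density matrix with the same reduced density matrices as `ρ` on every
`K ∈ 𝒦`, then `σ` is supported on `V`. -/
theorem supported_of_KCorrelated_of_same_rdm {n : ℕ} {d : Fin n → ℕ}
    (𝒦 : Finset (Finset (Fin n))) (V : Submodule ℂ (Idx d → ℂ))
    (hV : KCorrelated 𝒦 V)
    (ρ σ : Matrix (Idx d) (Idx d) ℂ)
    (hρ : IsDensityMatrix ρ) (hρV : LinearMap.range ρ.mulVecLin ≤ V)
    (hσ : IsDensityMatrix σ) (hrdm : ∀ K ∈ 𝒦, rdm K σ = rdm K ρ) :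
    LinearMap.range σ.mulVecLin ≤ V := by
  obtain ⟨P, hP, hmm, hmax⟩ := hV
  have hPh := hP.1
  have hPP := hP.2.1
  have hPρ := proj_mul_of_range hP hρV
  have hρP : ρ * P = ρ := by
    have := congrArg Matrix.conjTranspose hPρ
    rwa [Matrix.conjTranspose_mul, hPh.eq, hρ.1.1.eq] at this
  suffices hs : P * σ = σ by
    rintro _ ⟨w, rfl⟩
    rw [← hP.2.2]
    refine ⟨σ.mulVec w, ?_⟩
    rw [Matrix.mulVecLin_apply, Matrix.mulVecLin_apply, Matrix.mulVec_mulVec, hs]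
  apply support_of_trace hPh hPP hσ.1
  by_contra hne
  -- dimension
  obtain ⟨D, hDdef⟩ : ∃ D : ℝ, D = (Module.finrank ℂ V : ℝ) := ⟨_, rfl⟩
  have hmdef : mmix V P = ((D : ℂ))⁻¹ • P := by
    unfold mmix; rw [hDdef]; push_cast; rfl
  have hD0 : D ≠ 0 := by
    intro h0
    have := hmm.2
    rw [hmdef, h0] at this
    simp at this
  have hD : 0 < D := lt_of_le_of_ne (by rw [hDdef]; positivity) hD0.symm
  have hDc : (D : ℂ) ≠ 0 := by exact_mod_cast hD0
  rw [hmdef] at hmm hmax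
  have htrP : P.trace = D := by
    have := hmm.2
    rw [Matrix.trace_smul, smul_eq_mul] at this
    field_simp at this
    exact this
  have hPpsd : P.PosSemidef := by
    have := Matrix.posSemidef_conjTranspose_mul_self P
    rwa [hPh.eq, hPP] at this
  have hflat := entropy_flat_s1 _ hmm D hD (by
    rw [Matrix.smul_mul, Matrix.mul_smul, hPP])
  -- q
  have hQh : (1 - P).IsHermitian := Matrix.isHermitian_one.sub hPh
  have hQQ : (1 - P) * (1 - P) = 1 - P := by
    rw [Matrix.mul_sub, Matrix.sub_mul, Matrix.sub_mul, hPP]; simp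
  have hqr := trace_mul_self_real hQh hσ.1.1
  have hqnn : 0 ≤ ((1 - P) * σ).trace.re := by
    have h1 : ((1 - P) * σ * (1 - P).conjTranspose).PosSemidef := hσ.1.mul_mul_conjTranspose_same _
    have h2 := h1.trace_nonneg
    rw [Matrix.trace_mul_comm, hQh.eq, ← Matrix.mul_assoc, hQQ, hqr] at h2
    exact_mod_cast h2
  obtain ⟨q, hq⟩ : ∃ q : ℝ, q = ((1 - P) * σ).trace.re := ⟨_, rfl⟩
  rw [← hq] at hqr hqnn
  have hqpos : 0 < q := by
    refine lt_of_le_of_ne hqnn ?_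
    intro h0
    apply hne
    rw [hqr, ← h0]; simp
  have htPσ : (P * σ).trace = 1 - q := by
    rw [Matrix.sub_mul, Matrix.trace_sub, Matrix.one_mul, hσ.2] at hqr
    rw [← hqr]; ring
  have hσρ : σ ≠ ρ := by
    intro h0
    rw [h0, hPρ, hρ.2] at htPσ
    have : (q : ℂ) = 0 := by linear_combination htPσ
    have : q = 0 := by exact_mod_cast this
    linarith
  obtain ⟨C, hC⟩ : ∃ C : ℝ, ((σ - ρ) * (σ - ρ)).trace = (C : ℂ) :=
    ⟨_, trace_mul_self_real (hσ.1.1.sub hρ.1.1) (hσ.1.1.sub hρ.1.1)⟩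
  have hCp : 0 < |C| + 1 := by positivity
  obtain ⟨ε, hεdef⟩ : ∃ ε : ℝ, ε = min D⁻¹ (q / (D * (|C| + 1))) := ⟨_, rfl⟩
  have hε : 0 < ε := by rw [hεdef]; positivity
  have hε1 : ε ≤ D⁻¹ := by rw [hεdef]; exact min_le_left _ _
  have hε2 : ε * (D * (|C| + 1)) ≤ q := by
    rw [← le_div_iff₀ (by positivity), hεdef]; exact min_le_right _ _
  have hεc : (ε : ℂ) ≠ 0 := by exact_mod_cast hε.ne'
  -- the perturbed state
  have hPρpsd : (P - ρ).PosSemidef := by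
    have := (one_sub_posSemidef ρ hρ).mul_mul_conjTranspose_same P
    rwa [hPh.eq, Matrix.mul_sub, Matrix.sub_mul, Matrix.mul_one, hPP, hPρ, hρP] at this
  have hτ : IsDensityMatrix (((D : ℂ))⁻¹ • P + (ε : ℂ) • (σ - ρ)) := by
    constructor
    · have e : ((D : ℂ))⁻¹ • P + (ε : ℂ) • (σ - ρ) =
          ((D⁻¹ - ε : ℝ) : ℂ) • P + (ε : ℂ) • (P - ρ) + (ε : ℂ) • σ := by
        push_cast
        module
      rw [e]
      have a1 : (0 : ℂ) ≤ ((D⁻¹ - ε : ℝ) : ℂ) := by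
        have : 0 ≤ D⁻¹ - ε := by linarith
        exact_mod_cast this
      have a2 : (0 : ℂ) ≤ (ε : ℂ) := by exact_mod_cast hε.le
      exact ((hPpsd.smul a1).add (hPρpsd.smul a2)).add (hσ.1.smul a2)
    · rw [Matrix.trace_add, hmm.2, Matrix.trace_smul, Matrix.trace_sub, hσ.2, hρ.2]
      simp
  have hlt := hmax _ hτ (fun K hK => rdm_perturb K _ ρ σ _ (hrdm K hK)) (by
    intro h0
    have h1 : (ε : ℂ) • (σ - ρ) = 0 := by simpa using h0
    rcases smul_eq_zero.mp h1 with h2 | h2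
    · exact hεc h2
    · exact hσρ (sub_eq_zero.mp h2))
  rw [hflat] at hlt
  refine absurd (entropy_lower _ hτ D hD ?_) (not_le.mpr hlt)
  have htr : ((((D : ℂ))⁻¹ • P + (ε : ℂ) • (σ - ρ)) * (((D : ℂ))⁻¹ • P + (ε : ℂ) • (σ - ρ))).trace
      = ((D⁻¹ - 2 * ε * q * D⁻¹ + ε ^ 2 * C : ℝ) : ℂ) := by
    have t1 : (P * (σ - ρ)).trace = -q := by
      rw [Matrix.mul_sub, Matrix.trace_sub, htPσ, hPρ, hρ.2]; ring
    have t2 : ((σ - ρ) * P).trace = -q := by rw [Matrix.trace_mul_comm, t1]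
    simp only [Matrix.add_mul, Matrix.mul_add, Matrix.smul_mul, Matrix.mul_smul,
      Matrix.trace_add, Matrix.trace_smul, hPP, t1, t2, hC, htrP, smul_eq_mul]
    push_cast
    field_simp
    ring
  rw [htr, Complex.ofReal_re]
  have e : D * (D⁻¹ - 2 * ε * q * D⁻¹ + ε ^ 2 * C) = 1 - 2 * ε * q + ε * (ε * (D * C)) := by
    field_simp
  rw [e]
  have h3 : ε * (D * C) ≤ q := by
    refine le_trans ?_ hε2
    have : C ≤ |C| + 1 := by linarith [le_abs_self C]
    gcongr
  nlinarith [mul_le_mul_of_nonneg_left h3 hε.le, mul_pos hε hqpos]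

end Paper
end

section
/- Let K be an interaction pattern on an n-partite finite-dimensional Hilbert space H, and let V_1 and V_2 be K-correlated subspaces of H with V_1 ∩ V_2 ≠ {0}. Then V_1 ∩ V_2 is K-correlated. -/
open scoped BigOperators ComplexOrder

namespace Paper

lemma proj_exists {m : Type*} [Fintype m] [DecidableEq m] (V : Submodule ℂ (m → ℂ)) :
    ∃ P : Matrix m m ℂ, IsProjectionOnto P V := by
  let U : Submodule ℂ (EuclideanSpace ℂ m) := V.comap (WithLp.linearEquiv 2 ℂ (m → ℂ)).toLinearMap
  let f := Matrix.toEuclideanCLM (n := m) (𝕜 := ℂ)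
  have hU : IsStarProjection U.starProjection := isStarProjection_starProjection
  let P := f.symm U.starProjection
  have hP : f P = U.starProjection := f.apply_symm_apply _
  have hv : ∀ x : m → ℂ, P.mulVec x = (U.starProjection (WithLp.toLp 2 x)).ofLp := by
    intro x
    rw [← hP]
    rfl
  refine ⟨P, ?_, ?_, ?_⟩
  · have : star P = P := by
      apply (show Function.Injective f from EquivLike.injective f)
      rw [map_star, hP]
      exact hU.isSelfAdjoint
    exact this
  · apply (show Function.Injective f from EquivLike.injective f)
    rw [map_mul, hP]
    exact hU.isIdempotentElem
  · ext x
    constructor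
    · rintro ⟨y, rfl⟩
      rw [Matrix.mulVecLin_apply, hv]
      exact (U.starProjection_apply_mem (WithLp.toLp 2 y))
    · intro hx
      refine ⟨x, ?_⟩
      rw [Matrix.mulVecLin_apply, hv]
      have hxU : WithLp.toLp 2 x ∈ U := hx
      rw [Submodule.starProjection_eq_self_iff.mpr hxU]

lemma proj_apply {m : Type*} [Fintype m] [DecidableEq m] {V : Submodule ℂ (m → ℂ)}
    {P : Matrix m m ℂ} (hP : IsProjectionOnto P V) {x : m → ℂ} (hx : x ∈ V) :
    P.mulVec x = x := by
  rw [← hP.2.2] at hx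
  obtain ⟨y, rfl⟩ := hx
  rw [Matrix.mulVecLin_apply, Matrix.mulVec_mulVec, hP.2.1]

lemma proj_mul_iff {m : Type*} [Fintype m] [DecidableEq m] {V : Submodule ℂ (m → ℂ)}
    {P : Matrix m m ℂ} (hP : IsProjectionOnto P V) (A : Matrix m m ℂ) :
    P * A = A ↔ ∀ x, A.mulVec x ∈ V := by
  constructor
  · intro h x
    rw [← h, ← Matrix.mulVec_mulVec, ← hP.2.2]
    exact ⟨_, rfl⟩
  · intro h
    apply Matrix.ext_of_mulVec_single
    intro i
    rw [← Matrix.mulVec_mulVec, proj_apply hP (h _)]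

lemma proj_trace {m : Type*} [Fintype m] [DecidableEq m] {V : Submodule ℂ (m → ℂ)}
    {P : Matrix m m ℂ} (hP : IsProjectionOnto P V) :
    P.trace = (Module.finrank ℂ V : ℂ) := by
  have h : LinearMap.IsProj V (Matrix.toLin' P) := by
    constructor
    · intro x
      rw [← hP.2.2]
      exact ⟨x, rfl⟩
    · intro x hx
      exact proj_apply hP hx
  rw [← h.trace, Matrix.trace_toLin'_eq]

lemma proj_psd {m : Type*} [Fintype m] {P : Matrix m m ℂ} (h : P.IsHermitian)
    (h2 : P * P = P) : P.PosSemidef := by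
  have := Matrix.posSemidef_conjTranspose_mul_self P
  rwa [h.eq, h2] at this

open scoped MatrixOrder Matrix.Norms.L2Operator in
lemma psd_factor {m : Type*} [Fintype m] [DecidableEq m] {σ : Matrix m m ℂ}
    (hσ : σ.PosSemidef) : ∃ B : Matrix m m ℂ, σ = B.conjTranspose * B :=
  CStarAlgebra.nonneg_iff_eq_star_mul_self.mp hσ.nonneg

lemma psd_support {m : Type*} [Fintype m] [DecidableEq m] {P σ : Matrix m m ℂ}
    (h : P.IsHermitian) (h2 : P * P = P) (hσ : σ.PosSemidef)
    (ht : (P * σ).trace.re ≥ σ.trace.re) : P * σ = σ := by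
  obtain ⟨B, rfl⟩ := psd_factor hσ
  have hQ : (1 - P).IsHermitian := Matrix.isHermitian_one.sub h
  have hQ2 : (1 - P) * (1 - P) = 1 - P := by
    rw [mul_sub, sub_mul, sub_mul, h2]; simp
  have e : ((B * (1 - P)).conjTranspose * (B * (1 - P))).trace
      = (B.conjTranspose * B).trace - (P * (B.conjTranspose * B)).trace := by
    rw [Matrix.conjTranspose_mul, hQ.eq, ← Matrix.trace_sub]
    rw [Matrix.trace_mul_comm, Matrix.mul_assoc, ← Matrix.mul_assoc (1 - P) (1 - P), hQ2,
      Matrix.trace_mul_comm, Matrix.mul_assoc, sub_mul, one_mul]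
  have hn := (Matrix.posSemidef_conjTranspose_mul_self (B * (1 - P))).trace_nonneg
  have hz : ((B * (1 - P)).conjTranspose * (B * (1 - P))).trace = 0 := by
    rw [Complex.le_def] at hn
    apply Complex.ext
    · apply le_antisymm _ hn.1
      rw [e]; simp; exact ht
    · exact hn.2.symm
  rw [Matrix.trace_conjTranspose_mul_self_eq_zero_iff] at hz
  have hz' : (1 - P) * B.conjTranspose = 0 := by
    have := congrArg Matrix.conjTranspose hz
    rwa [Matrix.conjTranspose_mul, hQ.eq, Matrix.conjTranspose_zero] at this
  have : (1 - P) * (B.conjTranspose * B) = 0 := by rw [← Matrix.mul_assoc, hz', Matrix.zero_mul]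
  rw [sub_mul, one_mul, sub_eq_zero] at this
  exact this.symm

lemma sum_eig_s6 {m : Type*} [Fintype m] [DecidableEq m] {τ : Matrix m m ℂ}
    (hτ : IsDensityMatrix τ) : ∑ i, hτ.1.isHermitian.eigenvalues i = 1 := by
  have := hτ.1.isHermitian.trace_eq_sum_eigenvalues
  have h2 := this.symm.trans hτ.2
  have h3 := congrArg Complex.re h2
  simpa using h3

lemma sum_eig_sq {m : Type*} [Fintype m] [DecidableEq m] {τ : Matrix m m ℂ}
    (hτ : τ.IsHermitian) : ∑ i, (hτ.eigenvalues i) ^ 2 = (τ * τ).trace.re := by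
  have h : τ * τ = Unitary.conjStarAlgAut ℂ _ hτ.eigenvectorUnitary
      (Matrix.diagonal (RCLike.ofReal ∘ hτ.eigenvalues) *
        Matrix.diagonal (RCLike.ofReal ∘ hτ.eigenvalues)) := by
    rw [map_mul, ← hτ.spectral_theorem]
  rw [h, Unitary.conjStarAlgAut_apply, Matrix.trace_mul_comm, ← mul_assoc]
  simp [Matrix.trace_diagonal, pow_two]

lemma entropy_lower_s6 {m : Type*} [Fintype m] [DecidableEq m] {τ : Matrix m m ℂ}
    (hτ : IsDensityMatrix τ) {v : ℝ} (hv : 0 < v) :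
    Real.log v + 1 - v * (τ * τ).trace.re ≤ entropy τ := by
  have h1 := sum_eig_s6 hτ
  rw [← sum_eig_sq hτ.1.isHermitian, entropy, dif_pos hτ.1.isHermitian]
  have : Real.log v + 1 - v * ∑ i, (hτ.1.isHermitian.eigenvalues i) ^ 2
      = ∑ i, (hτ.1.isHermitian.eigenvalues i * (Real.log v + 1)
        - v * (hτ.1.isHermitian.eigenvalues i) ^ 2) := by
    rw [Finset.sum_sub_distrib, ← Finset.sum_mul, h1, Finset.mul_sum, one_mul]
  rw [this]
  apply Finset.sum_le_sum
  intro i _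
  have h0 := hτ.1.eigenvalues_nonneg i
  generalize hτ.1.isHermitian.eigenvalues i = x at h0 ⊢
  rcases h0.eq_or_lt with rfl | hx
  · simp
  · have := Real.log_le_sub_one_of_pos (mul_pos hv hx)
    rw [Real.log_mul hv.ne' hx.ne'] at this
    rw [Real.negMulLog]
    nlinarith

lemma entropy_upper {m : Type*} [Fintype m] [DecidableEq m] {τ P : Matrix m m ℂ}
    {V : Submodule ℂ (m → ℂ)} (hP : IsProjectionOnto P V)
    (hτ : IsDensityMatrix τ) (hPτ : P * τ = τ) (hv : 0 < Module.finrank ℂ V) :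
    entropy τ ≤ Real.log (Module.finrank ℂ V) ∧
      (Real.log (Module.finrank ℂ V) ≤ entropy τ → τ = mmix V P) := by
  have hrank : τ.rank ≤ Module.finrank ℂ V := by
    calc τ.rank = (P * τ).rank := by rw [hPτ]
      _ ≤ P.rank := Matrix.rank_mul_le_left _ _
      _ = _ := by rw [Matrix.rank, hP.2.2]
  rw [hτ.1.isHermitian.rank_eq_card_non_zero_eigs] at hrank
  have htr := proj_trace hP
  unfold mmix
  generalize Module.finrank ℂ V = w at *
  have h1 := sum_eig_s6 hτ
  have h2 := sum_eig_sq hτ.1.isHermitian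
  have h0 := hτ.1.eigenvalues_nonneg
  rw [entropy, dif_pos hτ.1.isHermitian]
  generalize hτ.1.isHermitian.eigenvalues = l at *
  have hw : (0 : ℝ) < w := by exact_mod_cast hv
  -- termwise bound
  have hterm : ∀ i, Real.negMulLog (l i) ≤
      l i * Real.log w + ((if l i ≠ 0 then (w : ℝ)⁻¹ else 0) - l i) := by
    intro i
    rcases (h0 i).eq_or_lt with hx | hx
    · simp [← hx]
    · rw [if_pos hx.ne']
      have := Real.log_le_sub_one_of_pos (x := (w * l i)⁻¹) (by positivity)
      rw [Real.log_inv, Real.log_mul hw.ne' hx.ne'] at this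
      have h3 := mul_le_mul_of_nonneg_left this hx.le
      have h4 : l i * ((w * l i)⁻¹ - 1) = (w : ℝ)⁻¹ - l i := by field_simp
      rw [Real.negMulLog]
      nlinarith
  have hsum : ∑ i, (l i * Real.log w + ((if l i ≠ 0 then (w : ℝ)⁻¹ else 0) - l i))
      ≤ Real.log w := by
    rw [Finset.sum_add_distrib, ← Finset.sum_mul, h1, Finset.sum_sub_distrib, h1,
      ← Finset.sum_filter, Finset.sum_const, nsmul_eq_mul]
    rw [Fintype.card_subtype] at hrank
    have : ((Finset.univ.filter fun i => l i ≠ 0).card : ℝ) * (w : ℝ)⁻¹ ≤ 1 := by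
      rw [← div_eq_mul_inv, div_le_one hw]
      exact_mod_cast hrank
    linarith
  refine ⟨(Finset.sum_le_sum fun i _ => hterm i).trans hsum, fun hge => ?_⟩
  have heq : ∀ i, Real.negMulLog (l i) =
      l i * Real.log w + ((if l i ≠ 0 then (w : ℝ)⁻¹ else 0) - l i) := by
    have := (Finset.sum_eq_sum_iff_of_le (fun i (_ : i ∈ Finset.univ) => hterm i)).mp
      (le_antisymm (Finset.sum_le_sum fun i _ => hterm i) (hsum.trans hge))
    exact fun i => this i (Finset.mem_univ i)
  have hsq : ∀ i, (l i) ^ 2 = (w : ℝ)⁻¹ * l i := by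
    intro i
    rcases (h0 i).eq_or_lt with hx | hx
    · simp [← hx]
    · have h5 := heq i
      rw [if_pos hx.ne'] at h5
      by_cases h6 : (w * l i)⁻¹ = 1
      · have : w * l i = 1 := inv_eq_one.mp h6
        field_simp
        linarith
      · exfalso
        have := Real.log_lt_sub_one_of_pos (x := (w * l i)⁻¹) (by positivity) h6
        rw [Real.log_inv, Real.log_mul hw.ne' hx.ne'] at this
        have h3 := mul_lt_mul_of_pos_left this hx
        have h4 : l i * ((w * l i)⁻¹ - 1) = (w : ℝ)⁻¹ - l i := by field_simp
        rw [Real.negMulLog] at h5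
        nlinarith
  have htt : (τ * τ).trace.re = (w : ℝ)⁻¹ := by
    rw [← h2, Finset.sum_congr rfl fun i _ => hsq i, ← Finset.mul_sum, h1, mul_one]
  have hwc : (w : ℂ) ≠ 0 := by exact_mod_cast hw.ne'
  let D := τ - (w : ℂ)⁻¹ • P
  have hτP : τ * P = τ := by
    have := congrArg Matrix.conjTranspose hPτ
    rwa [Matrix.conjTranspose_mul, hP.1.eq, hτ.1.isHermitian.eq] at this
  have hD : D.conjTranspose = D := by
    simp [D, hP.1.eq, hτ.1.isHermitian.eq]
  have hDD : (D.conjTranspose * D).trace = (τ * τ).trace - (w : ℂ)⁻¹ := by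
    rw [hD]
    simp only [D, mul_sub, sub_mul, Matrix.trace_sub, Matrix.smul_mul, Matrix.mul_smul,
      Matrix.trace_smul, hPτ, hτP, hP.2.1, htr, hτ.2, smul_eq_mul]
    field_simp
    ring
  have hn := (Matrix.posSemidef_conjTranspose_mul_self D).trace_nonneg
  have hz : (D.conjTranspose * D).trace = 0 := by
    rw [Complex.le_def] at hn
    apply Complex.ext
    · rw [hDD, Complex.sub_re, htt]
      have : ((w : ℂ)⁻¹).re = (w : ℝ)⁻¹ := by
        rw [← Complex.ofReal_natCast, ← Complex.ofReal_inv, Complex.ofReal_re]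
      rw [this]; simp
    · exact hn.2.symm
  rw [Matrix.trace_conjTranspose_mul_self_eq_zero_iff] at hz
  exact sub_eq_zero.mp hz

lemma finrank_pos_of_ne_bot {m : Type*} [Fintype m] {V : Submodule ℂ (m → ℂ)} (h : V ≠ ⊥) :
    0 < Module.finrank ℂ V := by
  rw [Nat.pos_iff_ne_zero]
  intro h0
  exact h (Submodule.finrank_eq_zero.mp h0)

lemma mmix_density {m : Type*} [Fintype m] [DecidableEq m] {P : Matrix m m ℂ}
    {V : Submodule ℂ (m → ℂ)} (hP : IsProjectionOnto P V) (hv : 0 < Module.finrank ℂ V) :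
    IsDensityMatrix (mmix V P) := by
  constructor
  · apply (proj_psd hP.1 hP.2.1).smul
    rw [inv_nonneg]
    exact Nat.cast_nonneg _
  · rw [mmix, Matrix.trace_smul, proj_trace hP, smul_eq_mul, inv_mul_cancel₀]
    exact_mod_cast hv.ne'

lemma rdm_comb {n : ℕ} {d : Fin n → ℕ} (K : Finset (Fin n)) (t : ℂ)
    (A B C : Matrix (Idx d) (Idx d) ℂ) (h : rdm K B = rdm K C) :
    rdm K (A + t • (B - C)) = rdm K A := by
  funext a b
  have := congrFun (congrFun h a) b
  simp only [rdm] at this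
  simp only [rdm, Matrix.add_apply, Matrix.smul_apply, Matrix.sub_apply, Finset.sum_add_distrib,
    ← Finset.smul_sum, Finset.sum_sub_distrib, this]
  simp

lemma support_le {n : ℕ} {d : Fin n → ℕ} (𝒦 : Finset (Finset (Fin n)))
    (V W : Submodule ℂ (Idx d → ℂ)) (hWV : W ≤ V) (hw : 0 < Module.finrank ℂ W)
    (P Q : Matrix (Idx d) (Idx d) ℂ) (hP : IsProjectionOnto P V) (hQ : IsProjectionOnto Q W)
    (hmax : ∀ σ : Matrix (Idx d) (Idx d) ℂ, IsDensityMatrix σ →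
      (∀ K ∈ 𝒦, rdm K σ = rdm K (mmix V P)) → σ ≠ mmix V P →
      entropy σ < entropy (mmix V P))
    (σ : Matrix (Idx d) (Idx d) ℂ) (hσ : IsDensityMatrix σ)
    (hr : ∀ K ∈ 𝒦, rdm K σ = rdm K (mmix W Q)) : P * σ = σ := by
  have hv : 0 < Module.finrank ℂ V := hw.trans_le (Submodule.finrank_mono hWV)
  have hPQ : P * Q = Q := by
    rw [proj_mul_iff hP]
    intro x
    apply hWV
    rw [← hQ.2.2]
    exact ⟨x, rfl⟩
  have hQP : Q * P = Q := by
    have := congrArg Matrix.conjTranspose hPQ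
    rwa [Matrix.conjTranspose_mul, hP.1.eq, hQ.1.eq] at this
  have hdV := mmix_density hP hv
  have hdW := mmix_density hQ hw
  have hup := (entropy_upper hP hdV (by rw [mmix, Matrix.mul_smul, hP.2.1]) hv).1
  have htP := proj_trace hP
  have htQ := proj_trace hQ
  by_contra hne
  have hq : 0 < 1 - (P * σ).trace.re := by
    by_contra hcon
    apply hne
    apply psd_support hP.1 hP.2.1 hσ.1
    rw [hσ.2, Complex.one_re]
    linarith
  set q := 1 - (P * σ).trace.re with hqdef
  set D := σ - mmix W Q with hD
  set c := (D * D).trace.re with hc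
  have hkey : ∀ t : ℝ, 0 < t → t ≤ (Module.finrank ℂ W : ℝ) / (Module.finrank ℂ V : ℝ) →
      2 * q < (Module.finrank ℂ V : ℝ) * t * c := by
    intro t ht ht2
    have hψ : IsDensityMatrix (mmix V P + (t : ℂ) • D) := by
      constructor
      · have e : mmix V P + (t : ℂ) • D =
            (((Module.finrank ℂ V : ℝ)⁻¹ : ℝ) : ℂ) • (P - Q) +
            ((((Module.finrank ℂ V : ℝ)⁻¹ - t * (Module.finrank ℂ W : ℝ)⁻¹ : ℝ)) : ℂ) • Q
            + (t : ℂ) • σ := by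
          simp only [hD, mmix]
          push_cast
          module
        rw [e]
        have hw' : (0 : ℝ) < Module.finrank ℂ W := by exact_mod_cast hw
        have hv' : (0 : ℝ) < Module.finrank ℂ V := by exact_mod_cast hv
        refine ((Matrix.PosSemidef.smul ?_ ?_).add (Matrix.PosSemidef.smul ?_ ?_)).add
          (Matrix.PosSemidef.smul hσ.1 ?_)
        · apply proj_psd (hP.1.sub hQ.1)
          rw [mul_sub, sub_mul, sub_mul, hPQ, hQP, hP.2.1, hQ.2.1]
          simp
        · rw [Complex.zero_le_real]; positivity
        · exact proj_psd hQ.1 hQ.2.1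
        · rw [Complex.zero_le_real, sub_nonneg, ← div_eq_mul_inv, div_le_iff₀ hw']
          rw [div_eq_inv_mul] at ht2
          exact ht2
        · rw [Complex.zero_le_real]; exact ht.le
      · rw [Matrix.trace_add, hdV.2, Matrix.trace_smul, hD, Matrix.trace_sub, hσ.2, hdW.2]
        simp
    have hlt := hmax _ hψ (fun K hK => rdm_comb K _ _ _ _ (hr K hK)) (by
      intro h
      have h3 : (t : ℂ) • D = 0 := by simpa using h
      rcases smul_eq_zero.mp h3 with h4 | h4
      · exact ht.ne' (by exact_mod_cast h4)
      · apply hne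
        rw [sub_eq_zero.mp h4, mmix, Matrix.mul_smul, hPQ])
    have hv' : (0 : ℝ) < Module.finrank ℂ V := by exact_mod_cast hv
    have hvc : (Module.finrank ℂ V : ℂ) ≠ 0 := by exact_mod_cast hv.ne'
    have hwc : (Module.finrank ℂ W : ℂ) ≠ 0 := by exact_mod_cast hw.ne'
    have hlow := entropy_lower_s6 hψ hv'
    have hPD : (P * D).trace = (P * σ).trace - 1 := by
      rw [hD, mmix, mul_sub, Matrix.mul_smul, hPQ, Matrix.trace_sub, Matrix.trace_smul, htQ,
        smul_eq_mul, inv_mul_cancel₀ hwc]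
    have hexp : ((mmix V P + (t : ℂ) • D) * (mmix V P + (t : ℂ) • D)).trace =
        (((Module.finrank ℂ V : ℝ)⁻¹ : ℝ) : ℂ) +
        ((2 * t * (Module.finrank ℂ V : ℝ)⁻¹ : ℝ) : ℂ) * ((P * σ).trace - 1)
          + ((t ^ 2 : ℝ) : ℂ) * (D * D).trace := by
      simp only [mmix, mul_add, add_mul, Matrix.smul_mul, Matrix.mul_smul, Matrix.trace_add,
        Matrix.trace_smul, Matrix.trace_mul_comm D P, hPD, hP.2.1, htP, smul_eq_mul]
      push_cast
      field_simp
      ring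
    have hre := congrArg Complex.re hexp
    rw [Complex.add_re, Complex.add_re, Complex.re_ofReal_mul, Complex.re_ofReal_mul,
      Complex.ofReal_re, Complex.sub_re, Complex.one_re, ← hc] at hre
    rw [hre] at hlow
    have h7 : (1 : ℝ) < Module.finrank ℂ V * ((Module.finrank ℂ V : ℝ)⁻¹ +
      2 * t * (Module.finrank ℂ V : ℝ)⁻¹ * ((P * σ).trace.re - 1) + t ^ 2 * c) := by linarith
    have h8 : (Module.finrank ℂ V : ℝ) * ((Module.finrank ℂ V : ℝ)⁻¹ +
      2 * t * (Module.finrank ℂ V : ℝ)⁻¹ * ((P * σ).trace.re - 1) + t ^ 2 * c)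
      = 1 + t * ((Module.finrank ℂ V : ℝ) * t * c - 2 * q) := by
      rw [hqdef]; field_simp; ring
    rw [h8] at h7
    have h9 : 0 < t * ((Module.finrank ℂ V : ℝ) * t * c - 2 * q) := by linarith
    have := (mul_pos_iff_of_pos_left ht).mp h9
    linarith
  have hw' : (0 : ℝ) < Module.finrank ℂ W := by exact_mod_cast hw
  have hv' : (0 : ℝ) < Module.finrank ℂ V := by exact_mod_cast hv
  generalize (Module.finrank ℂ V : ℝ) = v at *
  generalize (Module.finrank ℂ W : ℝ) = w at *
  have hden : 0 < v * |c| + 1 := by positivity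
  have hk := hkey (min (w / v) (q / (v * |c| + 1))) (lt_min (by positivity) (by positivity))
    (min_le_left _ _)
  have ht0 : 0 < min (w / v) (q / (v * |c| + 1)) := lt_min (by positivity) (by positivity)
  have ht1 := min_le_right (w / v) (q / (v * |c| + 1))
  generalize min (w / v) (q / (v * |c| + 1)) = t at *
  rw [le_div_iff₀ hden] at ht1
  have : v * t * c ≤ v * t * |c| := by
    apply mul_le_mul_of_nonneg_left (le_abs_self c); positivity
  nlinarith

/-- The nontrivial intersection of two `𝒦`-correlated subspaces is
`𝒦`-correlated. -/
theorem KCorrelated_inf {n : ℕ} {d : Fin n → ℕ} (𝒦 : Finset (Finset (Fin n)))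
    (V₁ V₂ : Submodule ℂ (Idx d → ℂ))
    (h₁ : KCorrelated 𝒦 V₁) (h₂ : KCorrelated 𝒦 V₂) (h₁₂ : V₁ ⊓ V₂ ≠ ⊥) :
    KCorrelated 𝒦 (V₁ ⊓ V₂) := by
  obtain ⟨P₁, hP₁, -, hm₁⟩ := h₁
  obtain ⟨P₂, hP₂, -, hm₂⟩ := h₂
  obtain ⟨Q, hQ⟩ := proj_exists (V₁ ⊓ V₂)
  have hw := finrank_pos_of_ne_bot h₁₂
  have hd := mmix_density hQ hw
  refine ⟨Q, hQ, hd, fun σ hσ hr hne => ?_⟩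
  have e₁ := support_le 𝒦 V₁ _ inf_le_left hw P₁ Q hP₁ hQ hm₁ σ hσ hr
  have e₂ := support_le 𝒦 V₂ _ inf_le_right hw P₂ Q hP₂ hQ hm₂ σ hσ hr
  have e : Q * σ = σ := (proj_mul_iff hQ σ).mpr fun x =>
    ⟨(proj_mul_iff hP₁ σ).mp e₁ x, (proj_mul_iff hP₂ σ).mp e₂ x⟩
  have hup := entropy_upper hQ hσ e hw
  have hlt : entropy σ < Real.log (Module.finrank ℂ ↥(V₁ ⊓ V₂)) := by
    by_contra hcon
    exact hne (hup.2 (not_lt.mp hcon))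
  have hw' : (0 : ℝ) < Module.finrank ℂ ↥(V₁ ⊓ V₂) := by exact_mod_cast hw
  have hlow := entropy_lower_s6 hd hw'
  have htr : (mmix (V₁ ⊓ V₂) Q * mmix (V₁ ⊓ V₂) Q).trace =
      (((Module.finrank ℂ ↥(V₁ ⊓ V₂) : ℝ)⁻¹ : ℝ) : ℂ) := by
    have hwc : (Module.finrank ℂ ↥(V₁ ⊓ V₂) : ℂ) ≠ 0 := by exact_mod_cast hw.ne'
    rw [mmix, Matrix.smul_mul, Matrix.mul_smul, hQ.2.1, Matrix.trace_smul, Matrix.trace_smul,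
      proj_trace hQ, smul_eq_mul, smul_eq_mul, inv_mul_cancel₀ hwc, mul_one]
    push_cast
    rfl
  rw [htr, Complex.ofReal_re, mul_inv_cancel₀ hw'.ne'] at hlow
  linarith

end Paper
end

section
/- Let |ψ⟩ = α|000⟩ + β|111⟩ be a three-qubit GHZ-type state with α, β ≠ 0 and |α|² + |β|² = 1, and let σ = |α|²|000⟩⟨000| + |β|²|111⟩⟨111|. Then σ ≠ |ψ⟩⟨ψ|, σ has the same two-qubit reduced density matrix as |ψ⟩⟨ψ| on every pair K ⊆ {1,2,3} with |K| = 2, and S(σ) = −|α|² log|α|² − |β|² log|β|² > 0 = S(|ψ⟩⟨ψ|). Consequently |ψ⟩ is not the unique ground state of any Hamiltonian on (ℂ²)^{⊗3} that is a sum of Hermitian terms each acting nontrivially on at most two of the three qubits. -/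
open scoped BigOperators ComplexOrder

namespace Paper

/-- Local dimensions of three qubits. -/
abbrev d3 : Fin 3 → ℕ := fun _ => 2

/-- The basis label `000`. -/
def c0 : Idx d3 := fun _ => 0

/-- The basis label `111`. -/
def c1 : Idx d3 := fun _ => 1

/-- The pattern of all subsets of at most two of the three qubits (2-locality). -/
def twoLocalPattern : Finset (Finset (Fin 3)) :=
  Finset.univ.filter (fun K => K.card ≤ 2)

lemma c0_ne_c1 : c0 ≠ c1 := by
  intro h
  have := congrFun h 0
  simp [c0, c1] at this

lemma entropy_diagonal {m : Type*} [Fintype m] [DecidableEq m] (f : m → ℝ) :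
    entropy (Matrix.diagonal (fun i => (f i : ℂ))) = ∑ i, Real.negMulLog (f i) := by
  have h : (Matrix.diagonal (fun i => (f i : ℂ))).IsHermitian := by
    apply Matrix.isHermitian_diagonal_of_self_adjoint
    ext i
    simp
  unfold entropy
  rw [dif_pos h]
  have h1 := h.roots_charpoly_eq_eigenvalues
  have h0 : (∏ i, (Polynomial.X - Polynomial.C (f i : ℂ))).roots =
      Finset.univ.val.map (fun i => (f i : ℂ)) := by
    have := Polynomial.roots_multiset_prod_X_sub_C (Finset.univ.val.map (fun i => (f i : ℂ)))
    rwa [Multiset.map_map] at this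
  rw [Matrix.charpoly_diagonal, h0] at h1
  have h2 := congrArg (fun s => (s.map (fun z : ℂ => Real.negMulLog z.re)).sum) h1
  simp only [Multiset.map_map, Function.comp_def, Complex.ofReal_re] at h2
  exact h2.symm

lemma entropy_proj {m : Type*} [Fintype m] [DecidableEq m] (P : Matrix m m ℂ)
    (hP : P * P = P) : entropy P = 0 := by
  unfold entropy
  split_ifs with h
  · apply Finset.sum_eq_zero
    intro i _
    have h1 := h.mulVec_eigenvectorBasis i
    have h2 : P.mulVec (P.mulVec (h.eigenvectorBasis i).ofLp) =
        P.mulVec (h.eigenvectorBasis i).ofLp := by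
      rw [Matrix.mulVec_mulVec, hP]
    rw [h1, Matrix.mulVec_smul, h1, smul_smul] at h2
    have h3 : (h.eigenvectorBasis i).ofLp ≠ 0 := by
      intro h0
      have := h.eigenvectorBasis.orthonormal.ne_zero i
      apply this
      ext j
      simpa using congrFun h0 j
    have h4 := smul_left_injective ℝ h3 h2
    have h5 : h.eigenvalues i = 0 ∨ h.eigenvalues i = 1 := by
      have : h.eigenvalues i * (h.eigenvalues i - 1) = 0 := by linarith
      rcases mul_eq_zero.mp this with h | h
      · exact Or.inl h
      · exact Or.inr (by linarith)
    rcases h5 with h | h <;> simp [h]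
  · rfl

/-- For a GHZ-type state `|ψ⟩ = α|000⟩ + β|111⟩` (`α, β ≠ 0`), the
mixed state `σ = |α|²|000⟩⟨000| + |β|²|111⟩⟨111|` differs from `|ψ⟩⟨ψ|`, has the same
two-qubit reduced density matrices on every pair, and has entropy
`−|α|²log|α|² − |β|²log|β|² > 0 = S(|ψ⟩⟨ψ|)`; consequently `|ψ⟩` is not the unique
ground state of any 2-local Hamiltonian on three qubits. -/
theorem ghz_type_not_unique_ground_state (α β : ℂ) (hα : α ≠ 0) (hβ : β ≠ 0)
    (hnorm : ‖α‖ ^ 2 + ‖β‖ ^ 2 = 1)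
    (ψ : Idx d3 → ℂ) (hψ : ψ = α • ket c0 + β • ket c1)
    (σ : Matrix (Idx d3) (Idx d3) ℂ)
    (hσ : σ = ((‖α‖ ^ 2 : ℝ) : ℂ) • pureDM (ket c0) +
      ((‖β‖ ^ 2 : ℝ) : ℂ) • pureDM (ket c1)) :
    σ ≠ pureDM ψ ∧
    (∀ K : Finset (Fin 3), K.card = 2 → rdm K σ = rdm K (pureDM ψ)) ∧
    (entropy σ = -(‖α‖ ^ 2 * Real.log (‖α‖ ^ 2)) - ‖β‖ ^ 2 * Real.log (‖β‖ ^ 2) ∧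
      0 < entropy σ ∧ entropy (pureDM ψ) = 0) ∧
    (∀ H : Matrix (Idx d3) (Idx d3) ℂ, IsKLocal twoLocalPattern H → ∀ E : ℝ,
      ¬ IsGroundStateSpace H E (Submodule.span ℂ {ψ})) := by
  have hne := c0_ne_c1
  have hne' := hne.symm
  have hψ0 : ψ c0 = α := by simp [hψ, ket, hne]
  have hψ1 : ψ c1 = β := by simp [hψ, ket, hne']
  have hψx : ∀ x, x ≠ c0 → x ≠ c1 → ψ x = 0 := by
    intro x h0 h1
    simp [hψ, ket, h0, h1]
  have haa : α * (starRingEnd ℂ) α = ((‖α‖ ^ 2 : ℝ) : ℂ) := by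
    rw [Complex.mul_conj']; simp
  have hbb : β * (starRingEnd ℂ) β = ((‖β‖ ^ 2 : ℝ) : ℂ) := by
    rw [Complex.mul_conj']; simp
  have hent : ∀ x y : Idx d3, (∃ i, x i = y i) → σ x y = pureDM ψ x y := by
    rintro x y ⟨i, hi⟩
    have h01 : ¬ (x = c0 ∧ y = c1) := by
      rintro ⟨rfl, rfl⟩; simp [c0, c1] at hi
    have h10 : ¬ (x = c1 ∧ y = c0) := by
      rintro ⟨rfl, rfl⟩; simp [c0, c1] at hi
    simp only [hσ, pureDM, Matrix.add_apply, Matrix.smul_apply, Matrix.vecMulVec_apply,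
      Pi.star_apply, smul_eq_mul, ket]
    by_cases hx0 : x = c0
    · subst hx0
      by_cases hy0 : y = c0
      · subst hy0; simp [hne, hψ0, haa]
      · have hy1 : y ≠ c1 := fun h => h01 ⟨rfl, h⟩
        simp [hy0, hy1, hψx y hy0 hy1]
    · by_cases hx1 : x = c1
      · subst hx1
        by_cases hy1 : y = c1
        · subst hy1; simp [hne', hψ1, hbb]
        · have hy0 : y ≠ c0 := fun h => h10 ⟨rfl, h⟩
          simp [hy0, hy1, hψx y hy0 hy1]
      · simp [hx0, hx1, hψx x hx0 hx1]
  have hα2 : 0 < ‖α‖ ^ 2 := by positivity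
  have hβ2 : 0 < ‖β‖ ^ 2 := by positivity
  have hS : entropy σ = -(‖α‖ ^ 2 * Real.log (‖α‖ ^ 2)) - ‖β‖ ^ 2 * Real.log (‖β‖ ^ 2) := by
    have hd : σ = Matrix.diagonal (fun x =>
        (((if x = c0 then ‖α‖ ^ 2 else if x = c1 then ‖β‖ ^ 2 else 0 : ℝ)) : ℂ)) := by
      ext x y
      simp only [hσ, pureDM, Matrix.add_apply, Matrix.smul_apply, Matrix.vecMulVec_apply,
        Pi.star_apply, smul_eq_mul, ket, Matrix.diagonal_apply]
      by_cases hxy : x = y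
      · subst hxy
        by_cases hx0 : x = c0
        · subst hx0; simp [hne]
        · by_cases hx1 : x = c1
          · subst hx1; simp [hne']
          · simp [hx0, hx1]
      · by_cases hx0 : x = c0
        · subst hx0; simp [hne, hxy, Ne.symm hxy]
        · by_cases hx1 : x = c1
          · subst hx1; simp [hne', hxy, Ne.symm hxy]
          · simp [hx0, hx1, hxy]
    rw [hd, entropy_diagonal, ← Finset.sum_subset (Finset.subset_univ {c0, c1})]
    · rw [Finset.sum_pair hne]
      simp only [hne', if_true, if_false, Real.negMulLog]
      ring
    · intro x _ hx
      simp only [Finset.mem_insert, Finset.mem_singleton, not_or] at hx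
      simp [hx.1, hx.2]
  refine ⟨?_, ?_, ⟨hS, ?_, ?_⟩, ?_⟩
  · intro h
    have h1 := congrFun (congrFun h c0) c1
    simp [hσ, pureDM, Matrix.vecMulVec_apply, ket, hne, hne', hψ0, hψ1, hα, hβ] at h1
  · intro K hK
    obtain ⟨i, hi⟩ : ∃ i, i ∉ K := by
      by_contra! h
      have : K = Finset.univ := Finset.eq_univ_iff_forall.mpr h
      subst this
      simp at hK
    ext a b
    unfold rdm
    refine Finset.sum_congr rfl fun c _ => hent _ _ ⟨i, ?_⟩
    simp [merge, hi]
  · rw [hS]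
    have h1 := Real.log_neg hα2 (by linarith)
    have h2 := Real.log_neg hβ2 (by linarith)
    nlinarith [mul_pos hα2 (neg_pos.mpr h1), mul_pos hβ2 (neg_pos.mpr h2)]
  · apply entropy_proj
    unfold pureDM
    rw [Matrix.vecMulVec_mul_vecMulVec]
    have : star ψ ⬝ᵥ ψ = 1 := by
      unfold dotProduct
      rw [← Finset.sum_subset (Finset.subset_univ {c0, c1})]
      · rw [Finset.sum_pair hne]
        simp only [Pi.star_apply, hψ0, hψ1, RCLike.star_def]
        rw [mul_comm, haa, mul_comm, hbb, ← Complex.ofReal_add, hnorm, Complex.ofReal_one]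
      · intro x _ hx
        simp only [Finset.mem_insert, Finset.mem_singleton, not_or] at hx
        simp [hψx x hx.1 hx.2]
    simp [this]
  · rintro H ⟨M, T, hH, hT⟩ E ⟨hpsd, hV⟩
    have hH01 : H c0 c1 = 0 := by
      rw [hH, Matrix.sum_apply]
      refine Finset.sum_eq_zero fun j _ => ?_
      obtain ⟨_, K, hK, B, hB⟩ := hT j
      rw [hB]
      unfold embed
      rw [if_neg]
      intro h
      obtain ⟨i, hi⟩ : ∃ i, i ∉ K := by
        by_contra! h
        have : K = Finset.univ := Finset.eq_univ_iff_forall.mpr h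
        subst this
        simp [twoLocalPattern] at hK
      have := congrFun h ⟨i, hi⟩
      simp [corestrict, c0, c1] at this
    have h1 := (hV ψ).1 (Submodule.mem_span_singleton_self ψ)
    have h2 := congrFun h1 c0
    have h3 : H.mulVec ψ c0 = H c0 c0 * α := by
      unfold Matrix.mulVec dotProduct
      rw [← Finset.sum_subset (Finset.subset_univ {c0, c1})]
      · rw [Finset.sum_pair hne]; simp [hH01, hψ0]
      · intro x _ hx
        simp only [Finset.mem_insert, Finset.mem_singleton, not_or] at hx
        simp [hψx x hx.1 hx.2]
    rw [h3, Pi.smul_apply, hψ0, smul_eq_mul] at h2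
    have h4 : H c0 c0 = E := mul_right_cancel₀ hα h2
    have hk : (ket c0 : Idx d3 → ℂ) = Pi.single c0 1 := by
      ext x; simp [ket, Pi.single_apply]
    have h5 := (hpsd.dotProduct_mulVec_zero_iff (ket c0)).1 (by
      rw [hk]
      simp [Matrix.sub_apply, h4])
    rw [Matrix.sub_mulVec, Matrix.smul_mulVec, Matrix.one_mulVec, sub_eq_zero] at h5
    have h6 := (hV (ket c0)).2 h5
    obtain ⟨t, ht⟩ := Submodule.mem_span_singleton.1 h6
    have e0 := congrFun ht c0
    have e1 := congrFun ht c1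
    simp [hψ0, hψ1, ket, hne', hβ] at e0 e1
    simp [e1] at e0

end Paper
end

section
/- Let n ≥ 3 and let |W(n)⟩ = (1/√n) Σ_{i=1}^n |r_i⟩ be the n-qubit W state, where |r_i⟩ is the computational basis state with a 1 in position i and 0 elsewhere. For 1 ≤ i ≤ n−1, let γ_{i,i+1} denote the reduced density matrix of |W(n)⟩ on qubits {i, i+1}. Then ∩_{i=1}^{n−1} ( range(γ_{i,i+1}) on qubits i,i+1, tensored with the identity on the remaining qubits ) = span{ |W(n)⟩, |0⟩^{⊗n} }. -/
open scoped BigOperators ComplexOrder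

namespace Paper

/-- Local dimensions of `n` qubits. -/
abbrev dq (n : ℕ) : Fin n → ℕ := fun _ => 2

/-- The nearest-neighbour pair `{i, i+1}` of qubits on a chain of `n` qubits. -/
def pairK (n : ℕ) (i : Fin (n - 1)) : Finset (Fin n) :=
  {⟨i.1, by have := i.isLt; omega⟩, ⟨i.1 + 1, by have := i.isLt; omega⟩}

/-- The basis label with a single `1` at position `j`. -/
def rq (n : ℕ) (j : Fin n) : Idx (dq n) := fun i => if i = j then 1 else 0

/-- The basis label `00…0`. -/
def zq (n : ℕ) : Idx (dq n) := fun _ => 0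

/-- The `n`-qubit W state `|W(n)⟩ = (1/√n) ∑ᵢ |rᵢ⟩`. -/
noncomputable def Wst (n : ℕ) : Idx (dq n) → ℂ :=
  ((Real.sqrt n : ℝ) : ℂ)⁻¹ • ∑ j : Fin n, ket (rq n j)

lemma idx_congr {n : ℕ} (y : Idx (dq n)) {s t : Fin n} (h : s = t) :
    (show Fin 2 from y s) = y t := by
  subst h; rfl

lemma Wst_apply (n : ℕ) (y : Idx (dq n)) [Decidable (∃ j, y = rq n j)] :
    Wst n y = ((Real.sqrt n : ℝ) : ℂ)⁻¹ * (if ∃ j, y = rq n j then 1 else 0) := by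
  have hinj : ∀ j k, rq n j = rq n k → j = k := by
    intro j k h
    by_contra hne
    have := congrFun h j
    simp [rq, hne] at this
  simp only [Wst, Pi.smul_apply, Finset.sum_apply, ket, smul_eq_mul]
  congr 1
  split_ifs with h
  · obtain ⟨j, rfl⟩ := h
    rw [Finset.sum_eq_single j]
    · simp
    · intro b _ hb
      rw [if_neg]
      intro h
      exact hb (hinj _ _ h).symm
    · simp
  · apply Finset.sum_eq_zero
    intro j _
    rw [if_neg]
    intro h'
    exact h ⟨j, h'⟩

lemma rq_comp (n : ℕ) (j : Fin n) (σ : Equiv.Perm (Fin n)) :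
    (fun i => rq n j (σ i)) = rq n (σ⁻¹ j) := by
  funext i
  simp only [rq, Equiv.Perm.eq_inv_iff_eq]

lemma Wst_perm (n : ℕ) (y : Idx (dq n)) (σ : Equiv.Perm (Fin n)) :
    Wst n (fun i => y (σ i)) = Wst n y := by
  classical
  rw [Wst_apply, Wst_apply]
  congr 2
  apply propext
  constructor
  · rintro ⟨j, hj⟩
    refine ⟨σ j, ?_⟩
    funext k
    have h1 := congrFun hj (σ⁻¹ k)
    have h2 : σ (σ⁻¹ k) = k := by simp
    have h3 : y (σ (σ⁻¹ k)) = y k := idx_congr y h2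
    rw [← h3]
    refine h1.trans ?_
    simp only [rq, Equiv.Perm.inv_eq_iff_eq]
  · rintro ⟨j, rfl⟩
    exact ⟨_, rq_comp n j σ⟩

lemma Wst_two (n : ℕ) (y : Idx (dq n)) (p q : Fin n) (hpq : p ≠ q) (hp : y p = 1) (hq : y q = 1) :
    Wst n y = 0 := by
  classical
  rw [Wst_apply, if_neg, mul_zero]
  rintro ⟨j, rfl⟩
  have h1 : p = j := by
    by_contra h
    simp [rq, h] at hp
  have h2 : q = j := by
    by_contra h
    simp [rq, h] at hq
  exact hpq (h1.trans h2.symm)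

/-- The coefficient matrix of the state across the cut `K`. -/
noncomputable def cutMat {n : ℕ} {d : Fin n → ℕ} (K : Finset (Fin n)) (ψ : Idx d → ℂ) :
    Matrix (SubIdx d K) (CoIdx d K) ℂ := fun a c => ψ (merge K a c)

lemma rdm_eq {n : ℕ} {d : Fin n → ℕ} (K : Finset (Fin n)) (ψ : Idx d → ℂ) :
    rdm K (pureDM ψ) = cutMat K ψ * (cutMat K ψ).conjTranspose := by
  ext a b
  simp [rdm, pureDM, cutMat, Matrix.mul_apply, Matrix.vecMulVec_apply]

lemma range_rdm {n : ℕ} {d : Fin n → ℕ} (K : Finset (Fin n)) (ψ : Idx d → ℂ) :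
    LinearMap.range (rdm K (pureDM ψ)).mulVecLin = LinearMap.range (cutMat K ψ).mulVecLin := by
  rw [rdm_eq]
  apply Submodule.eq_of_le_of_finrank_eq
  · rw [Matrix.mulVecLin_mul]
    exact LinearMap.range_comp_le_range _ _
  · exact Matrix.rank_self_mul_conjTranspose _

lemma slice_mem {n : ℕ} {d : Fin n → ℕ} (K : Finset (Fin n)) (ψ : Idx d → ℂ) (c : CoIdx d K) :
    (fun a => ψ (merge K a c)) ∈ LinearMap.range (rdm K (pureDM ψ)).mulVecLin := by
  rw [range_rdm]
  refine ⟨Pi.single c 1, ?_⟩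
  ext a
  simp [cutMat, Matrix.col_apply]

lemma merge_restrict {n : ℕ} {d : Fin n → ℕ} (K : Finset (Fin n)) (y : Idx d) :
    merge K (restrict K y) (corestrict K y) = y := by
  funext i
  simp [merge, restrict, corestrict]

lemma lift_zero {n : ℕ} {d : Fin n → ℕ} (K : Finset (Fin n)) (ψ x : Idx d → ℂ)
    (hx : x ∈ liftSpace K (LinearMap.range (rdm K (pureDM ψ)).mulVecLin)) (y : Idx d)
    (h : ∀ c, ψ (merge K (restrict K y) c) = 0) : x y = 0 := by
  have h1 := hx (corestrict K y)
  rw [range_rdm] at h1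
  obtain ⟨v, hv⟩ := h1
  have h2 := congrFun hv (restrict K y)
  simp only [merge_restrict] at h2
  rw [← h2]
  simp [Matrix.mulVec, dotProduct, cutMat, h]

lemma lift_eq {n : ℕ} {d : Fin n → ℕ} (K : Finset (Fin n)) (ψ x : Idx d → ℂ)
    (hx : x ∈ liftSpace K (LinearMap.range (rdm K (pureDM ψ)).mulVecLin)) (y z : Idx d)
    (hyz : corestrict K y = corestrict K z)
    (h : ∀ c, ψ (merge K (restrict K y) c) = ψ (merge K (restrict K z) c)) : x y = x z := by
  have h1 := hx (corestrict K y)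
  rw [range_rdm] at h1
  obtain ⟨v, hv⟩ := h1
  have h2 := congrFun hv (restrict K y)
  have h3 := congrFun hv (restrict K z)
  simp only [merge_restrict] at h2
  simp only [hyz, merge_restrict] at h3
  rw [← h2, ← h3]
  simp [Matrix.mulVec, dotProduct, cutMat, h]

lemma perm_inv (n : ℕ) (x : Idx (dq n) → ℂ)
    (h : ∀ (i : ℕ) (hi : i + 1 < n) (y : Idx (dq n)),
      x (fun k => y (Equiv.swap ⟨i, by omega⟩ ⟨i + 1, hi⟩ k)) = x y)
    (σ : Equiv.Perm (Fin n)) : ∀ y : Idx (dq n), x (fun k => y (σ k)) = x y := by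
  cases n with
  | zero =>
    intro y
    congr 1
    funext k
    exact k.elim0
  | succ m =>
    have hσ : σ ∈ Submonoid.closure
        (Set.range fun i : Fin m => Equiv.swap i.castSucc i.succ) := by
      rw [Equiv.Perm.mclosure_swap_castSucc_succ]; trivial
    induction hσ using Submonoid.closure_induction with
    | mem s hs =>
      obtain ⟨i, rfl⟩ := hs
      intro y
      exact h i.1 (by omega) y
    | one => intro y; rfl
    | mul a b _ _ ha hb =>
      intro y
      have := hb (fun k => y (a k))
      exact this.trans (ha y)

lemma mem_pair (n : ℕ) (i : Fin (n - 1)) (k : Fin n) :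
    k ∈ pairK n i ↔ k.1 = i.1 ∨ k.1 = i.1 + 1 := by
  simp [pairK, Fin.ext_iff]

lemma zero_slice (n : ℕ) (hn : 3 ≤ n) (i : Fin (n - 1)) (c : CoIdx (dq n) (pairK n i)) :
    (fun a => ket (zq n) (merge (pairK n i) a c)) ∈
      LinearMap.range (rdm (pairK n i) (pureDM (Wst n))).mulVecLin := by
  classical
  by_cases hc : ∀ k, c k = 0
  · obtain ⟨j, hj⟩ : ∃ j : Fin n, j ∉ pairK n i := by
      by_cases h0 : i.1 = 0
      · refine ⟨⟨2, by omega⟩, ?_⟩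
        rw [mem_pair]; simp [h0]
      · refine ⟨⟨0, by omega⟩, ?_⟩
        rw [mem_pair]; simp; omega
    have hs := slice_mem (pairK n i) (Wst n) (corestrict (pairK n i) (rq n j))
    have hs2 := Submodule.smul_mem _ ((Real.sqrt n : ℝ) : ℂ) hs
    convert hs2 using 1
    funext a
    have hne : ((Real.sqrt n : ℝ) : ℂ) ≠ 0 := by
      have : 0 < Real.sqrt n := Real.sqrt_pos.mpr (by exact_mod_cast (by omega : 0 < n))
      exact_mod_cast this.ne'
    simp only [Pi.smul_apply, smul_eq_mul, Wst_apply, ket]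
    rw [mul_inv_cancel_left₀ hne]
    congr 1
    apply propext
    constructor
    · intro h
      refine ⟨j, ?_⟩
      funext k
      by_cases hk : k ∈ pairK n i
      · have := congrFun h k
        have hkj : k ≠ j := fun e => hj (e ▸ hk)
        simp [merge, hk, zq] at this
        simp [merge, hk, rq, hkj, this]
      · simp [merge, hk, corestrict]
    · rintro ⟨l, hl⟩
      have hlj : j = l := by
        have := congrFun hl j
        by_contra hne
        simp [merge, hj, corestrict, rq, hne] at this
      subst hlj
      funext k
      by_cases hk : k ∈ pairK n i
      · have := congrFun hl k
        have hkj : k ≠ j := fun e => hj (e ▸ hk)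
        simp [merge, hk, rq, hkj] at this
        simp [merge, hk, zq, this]
      · simp [merge, hk, zq, hc]
  · push Not at hc
    obtain ⟨k, hk⟩ := hc
    have : (fun a => ket (zq n) (merge (pairK n i) a c)) = 0 := by
      funext a
      simp only [ket, Pi.zero_apply]
      rw [if_neg]
      intro h
      have := congrFun h k.1
      simp [merge, k.2, zq] at this
      exact hk this
    rw [this]
    exact Submodule.zero_mem _

lemma exists_perm (n : ℕ) (p q r s : Fin n) (hpq : p ≠ q) (hrs : r ≠ s) :
    ∃ σ : Equiv.Perm (Fin n), σ r = p ∧ σ s = q := by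
  refine ⟨Equiv.swap q (Equiv.swap r p s) * Equiv.swap r p, ?_, ?_⟩
  · have : p ≠ Equiv.swap r p s := by
      intro h
      have h' : Equiv.swap r p r = Equiv.swap r p s := by simpa using h
      exact hrs ((Equiv.swap r p).injective h')
    simp [Equiv.swap_apply_of_ne_of_ne hpq this]
  · simp

/-- For `n ≥ 3`, the intersection over all nearest-neighbour pairs
`{i, i+1}` of the subspaces `range(γ_{i,i+1}) ⊗ I` determined by the W state equals
`span{|W(n)⟩, |0…0⟩}`. -/
theorem w_state_intersection (n : ℕ) (hn : 3 ≤ n) :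
    (⨅ i : Fin (n - 1), liftSpace (pairK n i)
        (LinearMap.range (rdm (pairK n i) (pureDM (Wst n))).mulVecLin)) =
      Submodule.span ℂ {Wst n, ket (zq n)} := by
  classical
  apply le_antisymm
  · intro x hx
    rw [Submodule.mem_iInf] at hx
    have hsw : ∀ (i : ℕ) (hi : i + 1 < n) (y : Idx (dq n)),
        x (fun k => y (Equiv.swap ⟨i, by omega⟩ ⟨i + 1, hi⟩ k)) = x y := by
      intro i hi y
      have hmem := mem_pair n ⟨i, by omega⟩
      have hfix : ∀ k, k ∉ pairK n ⟨i, by omega⟩ →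
          Equiv.swap (⟨i, by omega⟩ : Fin n) ⟨i + 1, hi⟩ k = k := by
        intro k hk
        rw [hmem] at hk
        push Not at hk
        apply Equiv.swap_apply_of_ne_of_ne
        · intro h; exact hk.1 (by rw [h])
        · intro h; exact hk.2 (by rw [h])
      have hst : ∀ k, k ∈ pairK n ⟨i, by omega⟩ →
          Equiv.swap (⟨i, by omega⟩ : Fin n) ⟨i + 1, hi⟩ k ∈ pairK n ⟨i, by omega⟩ := by
        intro k hk
        rw [hmem] at hk
        rw [hmem]
        rcases hk with hk | hk
        · have : k = ⟨i, by omega⟩ := Fin.ext hk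
          rw [this, Equiv.swap_apply_left]; simp
        · have : k = ⟨i + 1, hi⟩ := Fin.ext hk
          rw [this, Equiv.swap_apply_right]; simp
      apply lift_eq _ _ _ (hx ⟨i, by omega⟩)
      · funext k
        simp only [corestrict]
        rw [hfix k.1 k.2]
      · intro c
        rw [← Wst_perm n (merge _ (restrict _ y) c) (Equiv.swap ⟨i, by omega⟩ ⟨i + 1, hi⟩)]
        congr 1
        funext k
        by_cases hk : k ∈ pairK n ⟨i, by omega⟩
        · simp only [merge, hk, hst k hk, restrict, dif_pos]
        · have h4 := idx_congr (merge (d := dq n) _ (restrict _ y) c) (hfix k hk)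
          refine Eq.trans ?_ h4.symm
          simp only [merge, hk, dif_neg, not_false_eq_true]
    have hperm := perm_inv n x hsw
    let p0 : Fin n := ⟨0, by omega⟩
    let p1 : Fin n := ⟨1, by omega⟩
    have h01 : p0 ≠ p1 := by simp [p0, p1]
    have hm0 : p0 ∈ pairK n ⟨0, by omega⟩ := by rw [mem_pair]; simp [p0]
    have hm1 : p1 ∈ pairK n ⟨0, by omega⟩ := by rw [mem_pair]; simp [p1]
    have htwo : ∀ (y : Idx (dq n)) (p q : Fin n), p ≠ q → y p = 1 → y q = 1 → x y = 0 := by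
      intro y p q hpq hp hq
      obtain ⟨σ, hσ0, hσ1⟩ := exists_perm n p q p0 p1 hpq h01
      rw [← hperm σ y]
      apply lift_zero _ _ _ (hx ⟨0, by omega⟩)
      intro c
      apply Wst_two n _ p0 p1 h01
      · simp only [merge, hm0, dif_pos, restrict]
        exact (idx_congr y hσ0).trans hp
      · simp only [merge, hm1, dif_pos, restrict]
        exact (idx_congr y hσ1).trans hq
    have hone : ∀ j, x (rq n j) = x (rq n p0) := by
      intro j
      have := hperm (Equiv.swap j p0) (rq n p0)
      rw [rq_comp] at this
      simpa using this
    have hne : ((Real.sqrt n : ℝ) : ℂ) ≠ 0 := by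
      have : 0 < Real.sqrt n := Real.sqrt_pos.mpr (by exact_mod_cast (by omega : 0 < n))
      exact_mod_cast this.ne'
    rw [Submodule.mem_span_pair]
    refine ⟨x (rq n p0) * ((Real.sqrt n : ℝ) : ℂ), x (zq n), ?_⟩
    funext y
    simp only [Pi.add_apply, Pi.smul_apply, smul_eq_mul, Wst_apply, ket]
    rw [mul_assoc, mul_inv_cancel_left₀ hne]
    have hbit : ∀ b : Fin 2, b = 0 ∨ b = 1 := by decide
    by_cases hz : y = zq n
    · subst hz
      rw [if_neg, if_pos rfl]
      · ring
      · rintro ⟨j, hj⟩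
        have := congrFun hj j
        simp [zq, rq] at this
    · rw [if_neg hz]
      obtain ⟨p, hp⟩ : ∃ p, y p = 1 := by
        by_contra hcon
        push Not at hcon
        exact hz (funext fun k => (hbit (y k)).resolve_right (hcon k))
      by_cases hr : ∃ j, y = rq n j
      · rw [if_pos hr]
        obtain ⟨j, rfl⟩ := hr
        rw [hone j]; ring
      · rw [if_neg hr]
        obtain ⟨q, hqp, hq⟩ : ∃ q, p ≠ q ∧ y q = 1 := by
          by_contra hcon
          push Not at hcon
          apply hr
          refine ⟨p, funext fun k => ?_⟩
          by_cases hk : k = p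
          · subst hk; simp [rq, hp]
          · simp only [rq, hk, if_false]
            exact (hbit (y k)).resolve_right (hcon k (Ne.symm hk))
        rw [htwo y p q hqp hp hq]; ring
  · rw [Submodule.span_le]
    rintro v (rfl | rfl)
    · simp only [SetLike.mem_coe, Submodule.mem_iInf]
      intro i c
      exact slice_mem _ _ c
    · simp only [SetLike.mem_coe, Submodule.mem_iInf]
      intro i c
      exact zero_slice n hn i c

end Paper
end

section
/- For every n ≥ 3 there exists a Hamiltonian H on (ℂ²)^{⊗n} of the form H = Σ_{i=1}^{n−1} H_{i,i+1}, where each H_{i,i+1} is a Hermitian operator acting nontrivially only on the nearest-neighbour pair of qubits {i, i+1} (tensored with the identity on all other qubits), such that the n-qubit W state |W(n)⟩ = (1/√n) Σ_{i=1}^n |r_i⟩ is the unique ground state of H. -/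
open scoped BigOperators ComplexOrder

namespace Paper

section WProof

variable {n : ℕ}

/-- left site of the pair -/
def pL (i : Fin (n - 1)) : Fin n := ⟨i.1, by have := i.isLt; omega⟩
/-- right site of the pair -/
def pR (i : Fin (n - 1)) : Fin n := ⟨i.1 + 1, by have := i.isLt; omega⟩

lemma pL_mem (i : Fin (n - 1)) : pL i ∈ pairK n i := by simp [pairK, pL]
lemma pR_mem (i : Fin (n - 1)) : pR i ∈ pairK n i := by simp [pairK, pR]
lemma mem_pairK (i : Fin (n - 1)) (k : Fin n) : k ∈ pairK n i ↔ k = pL i ∨ k = pR i := by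
  simp [pairK, pL, pR]
lemma pL_ne_pR (i : Fin (n - 1)) : pL i ≠ pR i := by simp [pL, pR]

/-- local number weight -/
def wt (i : Fin (n - 1)) (s t : Fin 2) : ℝ :=
  (if s = 1 then 1 else 0) + (if i.1 + 2 = n ∧ t = 1 then 1 else 0)

/-- both sites occupied -/
def oc (s t : Fin 2) : ℝ := if s = 1 ∧ t = 1 then 1 else 0

/-- The local term. -/
noncomputable def locB (C : ℝ) (i : Fin (n - 1)) :
    Matrix (SubIdx (dq n) (pairK n i)) (SubIdx (dq n) (pairK n i)) ℂ :=
  fun a b =>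
    (if a ⟨pL i, pL_mem i⟩ = b ⟨pL i, pL_mem i⟩ ∧ a ⟨pR i, pR_mem i⟩ = b ⟨pR i, pR_mem i⟩ then
      ((C + C * oc (a ⟨pL i, pL_mem i⟩) (a ⟨pR i, pR_mem i⟩)
        - wt i (a ⟨pL i, pL_mem i⟩) (a ⟨pR i, pR_mem i⟩) : ℝ) : ℂ) else 0)
    - (if a ⟨pL i, pL_mem i⟩ = b ⟨pR i, pR_mem i⟩ ∧ a ⟨pR i, pR_mem i⟩ = b ⟨pL i, pL_mem i⟩ then
      (C : ℂ) else 0)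

lemma locB_herm (C : ℝ) (i : Fin (n - 1)) : (locB C i).IsHermitian := by
  ext a b
  simp only [Matrix.conjTranspose_apply, locB, star_sub, apply_ite (star : ℂ → ℂ), star_zero,
    RCLike.star_def, Complex.conj_ofReal]
  congr 1
  · by_cases h : a ⟨pL i, pL_mem i⟩ = b ⟨pL i, pL_mem i⟩ ∧ a ⟨pR i, pR_mem i⟩ = b ⟨pR i, pR_mem i⟩
    · rw [if_pos h, if_pos ⟨h.1.symm, h.2.symm⟩, h.1, h.2]
    · rw [if_neg h, if_neg (fun h' => h ⟨h'.1.symm, h'.2.symm⟩)]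
  · congr 1
    apply propext
    constructor <;> rintro ⟨h1, h2⟩ <;> exact ⟨h2.symm, h1.symm⟩

/-- swapped configuration -/
def sw (i : Fin (n - 1)) (x : Idx (dq n)) : Idx (dq n) :=
  fun k => x (Equiv.swap (pL i) (pR i) k)

lemma sw_sw (i : Fin (n - 1)) (x : Idx (dq n)) : sw i (sw i x) = x := by
  funext k
  exact congrArg (β := Fin 2) (show Fin n → Fin 2 from x) (Equiv.swap_apply_self (pL i) (pR i) k)

lemma sw_L (i : Fin (n - 1)) (x : Idx (dq n)) : sw i x (pL i) = x (pR i) :=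
  congrArg (β := Fin 2) (show Fin n → Fin 2 from x) (Equiv.swap_apply_left (pL i) (pR i))

lemma sw_R (i : Fin (n - 1)) (x : Idx (dq n)) : sw i x (pR i) = x (pL i) :=
  congrArg (β := Fin 2) (show Fin n → Fin 2 from x) (Equiv.swap_apply_right (pL i) (pR i))

lemma sw_ne (i : Fin (n - 1)) (x : Idx (dq n)) (k : Fin n) (h1 : k ≠ pL i) (h2 : k ≠ pR i) :
    sw i x k = x k :=
  congrArg (β := Fin 2) (show Fin n → Fin 2 from x) (Equiv.swap_apply_of_ne_of_ne h1 h2)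

lemma corestrict_iff (i : Fin (n - 1)) (x y : Idx (dq n)) :
    corestrict (pairK n i) x = corestrict (pairK n i) y ↔
      ∀ k, k ≠ pL i → k ≠ pR i → x k = y k := by
  constructor
  · intro h k h1 h2
    have hk : k ∉ pairK n i := by rw [mem_pairK]; tauto
    exact congrFun h ⟨k, hk⟩
  · intro h
    funext ⟨k, hk⟩
    rw [mem_pairK] at hk
    exact h k (by tauto) (by tauto)

lemma embed_locB (C : ℝ) (i : Fin (n - 1)) (x y : Idx (dq n)) :
    embed (pairK n i) (locB C i) x y =
      (if x = y then
        ((C + C * oc (x (pL i)) (x (pR i)) - wt i (x (pL i)) (x (pR i)) : ℝ) : ℂ) else 0)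
      - (if sw i x = y then (C : ℂ) else 0) := by
  have e1 : x = y ↔ corestrict (pairK n i) x = corestrict (pairK n i) y ∧
      (x (pL i) = y (pL i) ∧ x (pR i) = y (pR i)) := by
    rw [corestrict_iff]
    constructor
    · rintro rfl; simp
    · rintro ⟨h, h1, h2⟩
      funext k
      by_cases k1 : k = pL i
      · rw [k1, h1]
      by_cases k2 : k = pR i
      · rw [k2, h2]
      exact h k k1 k2
  have e2 : sw i x = y ↔ corestrict (pairK n i) x = corestrict (pairK n i) y ∧
      (x (pL i) = y (pR i) ∧ x (pR i) = y (pL i)) := by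
    rw [corestrict_iff]
    constructor
    · rintro rfl
      refine ⟨fun k h1 h2 => ?_, ?_, ?_⟩
      · exact (sw_ne i x k h1 h2).symm
      · exact (sw_R i x).symm
      · exact (sw_L i x).symm
    · rintro ⟨h, h1, h2⟩
      funext k
      by_cases k1 : k = pL i
      · rw [k1, sw_L, h2]
      by_cases k2 : k = pR i
      · rw [k2, sw_R, h1]
      rw [← h k k1 k2, sw_ne i x k k1 k2]
  rw [embed]
  by_cases hc : corestrict (pairK n i) x = corestrict (pairK n i) y
  · simp only [e1, e2, hc, true_and, if_true]
    rfl
  · simp only [e1, e2, hc, false_and, if_false, sub_zero]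

/-- occupation number -/
def Nf (x : Idx (dq n)) : ℝ := ∑ i : Fin (n - 1), wt i (x (pL i)) (x (pR i))

/-- the quadratic form of the frustration-free part -/
noncomputable def Qf (v : Idx (dq n) → ℂ) : ℝ :=
  ∑ i : Fin (n - 1), ∑ x : Idx (dq n),
    (oc (x (pL i)) (x (pR i)) * ‖v x‖ ^ 2 + 1 / 2 * ‖v x - v (sw i x)‖ ^ 2)

lemma oc_nonneg (s t : Fin 2) : 0 ≤ oc s t := by unfold oc; split_ifs <;> norm_num

lemma Qterm_nonneg (v : Idx (dq n) → ℂ) (i : Fin (n - 1)) (x : Idx (dq n)) :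
    0 ≤ oc (x (pL i)) (x (pR i)) * ‖v x‖ ^ 2 + 1 / 2 * ‖v x - v (sw i x)‖ ^ 2 := by
  have := oc_nonneg (x (pL i)) (x (pR i))
  positivity

lemma Qterm_le (v : Idx (dq n) → ℂ) (i : Fin (n - 1)) (x : Idx (dq n)) :
    oc (x (pL i)) (x (pR i)) * ‖v x‖ ^ 2 + 1 / 2 * ‖v x - v (sw i x)‖ ^ 2 ≤ Qf v := by
  unfold Qf
  refine le_trans ?_ (Finset.single_le_sum (f := fun i => ∑ x : Idx (dq n),
    (oc (x (pL i)) (x (pR i)) * ‖v x‖ ^ 2 + 1 / 2 * ‖v x - v (sw i x)‖ ^ 2))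
    (fun j _ => Finset.sum_nonneg fun y _ => Qterm_nonneg v j y) (Finset.mem_univ i))
  exact Finset.single_le_sum (f := fun x : Idx (dq n) =>
    (oc (x (pL i)) (x (pR i)) * ‖v x‖ ^ 2 + 1 / 2 * ‖v x - v (sw i x)‖ ^ 2))
    (fun y _ => Qterm_nonneg v i y) (Finset.mem_univ x)

lemma Qf_nonneg (v : Idx (dq n) → ℂ) : 0 ≤ Qf v :=
  Finset.sum_nonneg fun j _ => Finset.sum_nonneg fun y _ => Qterm_nonneg v j y

lemma diff_le (v : Idx (dq n) → ℂ) (i : Fin (n - 1)) (x : Idx (dq n)) :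
    ‖v x - v (sw i x)‖ ^ 2 ≤ 2 * Qf v := by
  have h := Qterm_le v i x
  have := mul_nonneg (oc_nonneg (x (pL i)) (x (pR i))) (sq_nonneg ‖v x‖)
  linarith

lemma adj_le (v : Idx (dq n) → ℂ) (i : Fin (n - 1)) (x : Idx (dq n))
    (h1 : x (pL i) = 1) (h2 : x (pR i) = 1) : ‖v x‖ ^ 2 ≤ Qf v := by
  have h := Qterm_le v i x
  have h3 : oc (x (pL i)) (x (pR i)) = 1 := by simp [oc, h1, h2]
  rw [h3] at h
  nlinarith [sq_nonneg ‖v x - v (sw i x)‖]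

lemma norm_sq_bd (a b : ℂ) : ‖a‖ ^ 2 ≤ 2 * ‖a - b‖ ^ 2 + 2 * ‖b‖ ^ 2 := by
  have h : ‖a‖ ≤ ‖a - b‖ + ‖b‖ := by simpa using norm_add_le (a - b) b
  have h0 := norm_nonneg a
  nlinarith [sq_nonneg (‖a - b‖ - ‖b‖)]

lemma two_ones (g : ℕ) : ∀ (x : Idx (dq n)) (k l : Fin n), l.1 = k.1 + g + 1 →
    x k = 1 → x l = 1 → ∃ c : ℝ, 0 ≤ c ∧ ∀ v, ‖v x‖ ^ 2 ≤ c * Qf v := by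
  induction g with
  | zero =>
    intro x k l hl hk hl1
    have hi : k.1 < n - 1 := by have := l.isLt; omega
    refine ⟨1, zero_le_one, fun v => ?_⟩
    rw [one_mul]
    refine adj_le v ⟨k.1, hi⟩ x hk ?_
    rw [← hl1]; congr 1; ext; simp [pR]; omega
  | succ g ih =>
    intro x k l hl hk hl1
    have hi : k.1 < n - 1 := by have := l.isLt; omega
    set i : Fin (n - 1) := ⟨k.1, hi⟩ with hidef
    have hkL : pL i = k := rfl
    have h1 : (sw i x) (pR i) = 1 := by rw [sw_R, hkL, hk]
    have h2 : (sw i x) l = 1 := by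
      have a1 : l ≠ pL i := by intro h; rw [h, hkL] at hl; omega
      have a2 : l ≠ pR i := by
        intro h
        have h' : (pR i).1 = k.1 + 1 := rfl
        rw [h, h'] at hl; omega
      rw [sw_ne i x l a1 a2, hl1]
    obtain ⟨c, hc, hv⟩ := ih (sw i x) (pR i) l (by simp [pR, hidef]; omega) h1 h2
    refine ⟨4 + 2 * c, by positivity, fun v => ?_⟩
    have := norm_sq_bd (v x) (v (sw i x))
    have := diff_le v i x
    have := hv v
    linarith

/-- at least two ones -/
def Two (x : Idx (dq n)) : Prop := ∃ k l : Fin n, k < l ∧ x k = 1 ∧ x l = 1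

lemma two_bd (x : Idx (dq n)) (h : Two x) : ∃ c : ℝ, 0 ≤ c ∧ ∀ v, ‖v x‖ ^ 2 ≤ c * Qf v := by
  obtain ⟨k, l, hkl, h1, h2⟩ := h
  have : k.1 < l.1 := hkl
  exact two_ones (l.1 - k.1 - 1) x k l (by omega) h1 h2

lemma fin2 : ∀ t : Fin 2, t ≠ 1 → t = 0 := by decide

lemma trichotomy (x : Idx (dq n)) : x = 0 ∨ (∃ j, x = rq n j) ∨ Two x := by
  by_cases h0 : ∃ j, x j = 1
  · obtain ⟨j, hj⟩ := h0
    right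
    by_cases h : ∃ k, k ≠ j ∧ x k = 1
    · right
      obtain ⟨k, hk, hk1⟩ := h
      rcases lt_or_gt_of_ne hk with h | h
      · exact ⟨k, j, h, hk1, hj⟩
      · exact ⟨j, k, h, hj, hk1⟩
    · left
      refine ⟨j, ?_⟩
      funext k
      by_cases hk : k = j
      · subst hk; simp [rq, hj]
      · have : x k ≠ 1 := fun h' => h ⟨k, hk, h'⟩
        simp only [rq, hk, if_false]
        exact fin2 _ this
  · left
    funext k
    have : x k ≠ 1 := fun h' => h0 ⟨k, h'⟩
    show x k = 0
    exact fin2 _ this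

lemma Nf_zero : Nf (0 : Idx (dq n)) = 0 := by
  unfold Nf; apply Finset.sum_eq_zero; intro i _; simp [wt]

lemma Nf_rq (hn : 3 ≤ n) (j : Fin n) : Nf (rq n j) = 1 := by
  unfold Nf
  have key : ∀ i : Fin (n - 1), wt i (rq n j (pL i)) (rq n j (pR i)) =
      if (i.1 = j.1 ∨ (i.1 + 2 = n ∧ i.1 + 1 = j.1)) then 1 else 0 := by
    intro i
    have e1 : rq n j (pL i) = 1 ↔ i.1 = j.1 := by simp [rq, pL, Fin.ext_iff]
    have e2 : rq n j (pR i) = 1 ↔ i.1 + 1 = j.1 := by simp [rq, pR, Fin.ext_iff]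
    unfold wt
    rw [if_congr e1 rfl rfl, if_congr (and_congr Iff.rfl e2) rfl rfl]
    by_cases a : i.1 = j.1
    · have : ¬ (i.1 + 1 = j.1) := by omega
      simp [a]
    · simp [a]
  simp_rw [key]
  by_cases hj : j.1 < n - 1
  · rw [Finset.sum_eq_single ⟨j.1, hj⟩]
    · simp
    · intro b _ hb
      have : b.1 ≠ j.1 := fun h => hb (Fin.ext h)
      rw [if_neg]; omega
    · simp
  · have hj2 := j.isLt
    rw [Finset.sum_eq_single ⟨n - 2, by omega⟩]
    · rw [if_pos]; right; constructor <;> simp <;> omega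
    · intro b _ hb
      have : b.1 ≠ n - 2 := fun h => hb (Fin.ext h)
      have := b.isLt
      rw [if_neg]; omega
    · simp

lemma exists_C (hn : 3 ≤ n) : ∃ C : ℝ, ∀ v : Idx (dq n) → ℂ,
    Qf v + ‖v 0‖ ^ 2 ≤ C * Qf v - ∑ x, (Nf x - 1) * ‖v x‖ ^ 2 := by
  have : ∀ x : Idx (dq n), ∃ c : ℝ, ∀ v : Idx (dq n) → ℂ,
      (Nf x - 1) * ‖v x‖ ^ 2 ≤ c * Qf v - (if x = 0 then ‖v 0‖ ^ 2 else 0) := by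
    intro x
    by_cases h0 : x = 0
    · subst h0
      exact ⟨0, fun v => by simp [Nf_zero]⟩
    rcases trichotomy x with h | ⟨j, rfl⟩ | h
    · exact absurd h h0
    · exact ⟨0, fun v => by simp [Nf_rq hn, h0]⟩
    · obtain ⟨c, hc, hv⟩ := two_bd x h
      refine ⟨|Nf x - 1| * c, fun v => ?_⟩
      rw [if_neg h0, sub_zero, mul_assoc]
      exact mul_le_mul (le_abs_self _) (hv v) (by positivity) (abs_nonneg _)
  choose c hc using this
  refine ⟨1 + ∑ x, c x, fun v => ?_⟩
  have := Finset.sum_le_sum (s := Finset.univ) fun x _ => hc x v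
  rw [Finset.sum_sub_distrib, ← Finset.sum_mul] at this
  simp only [Finset.sum_ite_eq', Finset.mem_univ, if_true] at this
  linarith

/-- swap as an equivalence -/
def swE (i : Fin (n - 1)) : Idx (dq n) ≃ Idx (dq n) := ⟨sw i, sw i, sw_sw i, sw_sw i⟩

lemma swap_form (i : Fin (n - 1)) (v : Idx (dq n) → ℂ) :
    ∑ x, star (v x) * (v x - v (sw i x)) =
      ((∑ x, 1 / 2 * ‖v x - v (sw i x)‖ ^ 2 : ℝ) : ℂ) := by
  have h : ∑ x, star (v x) * (v x - v (sw i x)) =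
      ∑ x, star (v (sw i x)) * (v (sw i x) - v x) := by
    rw [← (swE i).sum_comp]
    apply Finset.sum_congr rfl
    intro x _
    show star (v (sw i x)) * (v (sw i x) - v (sw i (sw i x))) = _
    rw [sw_sw]
  have h2 : ∑ x, star (v x) * (v x - v (sw i x)) = 1 / 2 *
      (∑ x, star (v x) * (v x - v (sw i x)) + ∑ x, star (v (sw i x)) * (v (sw i x) - v x)) := by
    rw [← h]; ring
  rw [h2, ← Finset.sum_add_distrib, Finset.mul_sum]
  push_cast
  apply Finset.sum_congr rfl
  intro x _
  rw [← Complex.conj_mul']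
  simp only [RCLike.star_def, map_sub]
  ring

lemma form_eq (C : ℝ) (v : Idx (dq n) → ℂ) :
    star v ⬝ᵥ ((∑ i, embed (pairK n i) (locB C i)) - ((-1 : ℝ) : ℂ) • 1).mulVec v =
      ((C * Qf v - ∑ x, (Nf x - 1) * ‖v x‖ ^ 2 : ℝ) : ℂ) := by
  have hterm : ∀ i : Fin (n - 1), star v ⬝ᵥ (embed (pairK n i) (locB C i)).mulVec v =
      ((C * ∑ x : Idx (dq n), (oc (x (pL i)) (x (pR i)) * ‖v x‖ ^ 2
        + 1 / 2 * ‖v x - v (sw i x)‖ ^ 2)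
        - ∑ x, wt i (x (pL i)) (x (pR i)) * ‖v x‖ ^ 2 : ℝ) : ℂ) := by
    intro i
    have hm : ∀ x, (embed (pairK n i) (locB C i)).mulVec v x =
        C * (v x - v (sw i x)) + C * oc (x (pL i)) (x (pR i)) * v x
          - wt i (x (pL i)) (x (pR i)) * v x := by
      intro x
      simp only [Matrix.mulVec, dotProduct, embed_locB, sub_mul, ite_mul, zero_mul,
        Finset.sum_sub_distrib, Finset.sum_ite_eq, Finset.mem_univ, if_true]
      push_cast
      ring
    have hs : star v ⬝ᵥ (embed (pairK n i) (locB C i)).mulVec v =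
        C * ∑ x, star (v x) * (v x - v (sw i x)) +
        ∑ x, ((C * (oc (x (pL i)) (x (pR i)) * ‖v x‖ ^ 2)
          - wt i (x (pL i)) (x (pR i)) * ‖v x‖ ^ 2 : ℝ) : ℂ) := by
      rw [Finset.mul_sum, ← Finset.sum_add_distrib]
      simp only [dotProduct, hm]
      apply Finset.sum_congr rfl
      intro x _
      push_cast
      rw [← Complex.conj_mul']
      simp only [Pi.star_apply, RCLike.star_def]
      ring
    rw [hs, swap_form, ← Complex.ofReal_sum, ← Complex.ofReal_mul, ← Complex.ofReal_add]
    congr 1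
    rw [Finset.sum_sub_distrib, Finset.sum_add_distrib, ← Finset.mul_sum, ← Finset.mul_sum]
    ring
  have hid : star v ⬝ᵥ v = ((∑ x, ‖v x‖ ^ 2 : ℝ) : ℂ) := by
    simp only [dotProduct]
    push_cast
    apply Finset.sum_congr rfl
    intro x _
    rw [← Complex.conj_mul']
    rfl
  rw [Matrix.sub_mulVec, Matrix.smul_mulVec, Matrix.one_mulVec, dotProduct_sub, dotProduct_smul,
    hid, Matrix.sum_mulVec, dotProduct_sum]
  simp only [hterm]
  rw [← Complex.ofReal_sum, smul_eq_mul, ← Complex.ofReal_mul, ← Complex.ofReal_sub]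
  congr 1
  rw [Finset.sum_sub_distrib, ← Finset.mul_sum]
  simp only [sub_mul, Finset.sum_sub_distrib, one_mul, Nf, Finset.sum_mul]
  rw [Finset.sum_comm (s := (Finset.univ : Finset (Idx (dq n))))]
  unfold Qf
  ring

lemma rq_inj (j k : Fin n) : rq n j = rq n k ↔ j = k := by
  constructor
  · intro h
    have := congrFun h j
    by_contra hne
    simp [rq, hne] at this
  · rintro rfl; rfl

lemma rq_ne_zero (j : Fin n) : rq n j ≠ 0 := by
  intro h
  have := congrFun h j
  simp [rq] at this

lemma two_ne_rq (x : Idx (dq n)) (h : Two x) (j : Fin n) : x ≠ rq n j := by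
  rintro rfl
  obtain ⟨k, l, hkl, h1, h2⟩ := h
  simp [rq] at h1 h2
  subst h1; subst h2
  exact lt_irrefl _ hkl

lemma Wst_rq (j : Fin n) : Wst n (rq n j) = ((Real.sqrt n : ℝ) : ℂ)⁻¹ := by
  simp [Wst, ket, Finset.sum_apply, rq_inj]

lemma Wst_other (x : Idx (dq n)) (h : ∀ j, x ≠ rq n j) : Wst n x = 0 := by
  simp [Wst, ket, Finset.sum_apply, h]

lemma sw_rq (i : Fin (n - 1)) (j : Fin n) :
    sw i (rq n j) = rq n (Equiv.swap (pL i) (pR i) j) := by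
  funext k
  simp only [sw, rq, Equiv.swap_apply_eq_iff]

lemma Wst_sw (i : Fin (n - 1)) (x : Idx (dq n)) : Wst n (sw i x) = Wst n x := by
  by_cases h : ∃ j, x = rq n j
  · obtain ⟨j, rfl⟩ := h
    rw [sw_rq, Wst_rq, Wst_rq]
  · push Not at h
    rw [Wst_other x h, Wst_other]
    intro j hj
    apply h (Equiv.swap (pL i) (pR i) j)
    rw [← sw_rq, ← hj, sw_sw]

lemma Qf_Wst : Qf (Wst n) = 0 := by
  unfold Qf
  apply Finset.sum_eq_zero; intro i _
  apply Finset.sum_eq_zero; intro x _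
  rw [Wst_sw]
  by_cases h : x (pL i) = 1 ∧ x (pR i) = 1
  · have : Two x := ⟨pL i, pR i, by simp [pL, pR, Fin.lt_def], h.1, h.2⟩
    rw [Wst_other x (two_ne_rq x this)]; simp
  · simp [oc, h]

lemma Nsum_Wst (hn : 3 ≤ n) : ∑ x, (Nf x - 1) * ‖Wst n x‖ ^ 2 = 0 := by
  apply Finset.sum_eq_zero; intro x _
  by_cases h : ∃ j, x = rq n j
  · obtain ⟨j, rfl⟩ := h
    simp [Nf_rq hn]
  · push Not at h
    simp [Wst_other x h]

lemma eq_of_Q (hn : 3 ≤ n) (v : Idx (dq n) → ℂ) (hQ : Qf v = 0) (h0 : v 0 = 0) :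
    v ∈ Submodule.span ℂ {Wst n} := by
  have hsw : ∀ i x, v x = v (sw i x) := by
    intro i x
    have h := diff_le v i x
    rw [hQ, mul_zero] at h
    have : ‖v x - v (sw i x)‖ = 0 := by
      have := sq_nonneg ‖v x - v (sw i x)‖
      exact pow_eq_zero_iff (two_ne_zero) |>.1 (le_antisymm h this)
    exact sub_eq_zero.1 (norm_eq_zero.1 this)
  have htwo : ∀ x, Two x → v x = 0 := by
    intro x hx
    obtain ⟨c, hc, hv⟩ := two_bd x hx
    have h := hv v
    rw [hQ, mul_zero] at h
    exact norm_eq_zero.1 (pow_eq_zero_iff (two_ne_zero) |>.1 (le_antisymm h (sq_nonneg _)))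
  have hr : ∀ (k : ℕ) (hk : k < n), v (rq n ⟨k, hk⟩) = v (rq n ⟨0, by omega⟩) := by
    intro k
    induction k with
    | zero => intro hk; rfl
    | succ k ih =>
      intro hk
      rw [← ih (by omega)]
      have := hsw ⟨k, by omega⟩ (rq n ⟨k, by omega⟩)
      rw [this, sw_rq]
      congr 2
      symm
      exact Equiv.swap_apply_left (pL (n := n) ⟨k, by omega⟩) (pR ⟨k, by omega⟩)
  have hs : ((Real.sqrt n : ℝ) : ℂ) ≠ 0 := by
    rw [Complex.ofReal_ne_zero]
    exact (Real.sqrt_pos.2 (by exact_mod_cast (by omega : 0 < n))).ne'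
  rw [Submodule.mem_span_singleton]
  refine ⟨v (rq n ⟨0, by omega⟩) * ((Real.sqrt n : ℝ) : ℂ), ?_⟩
  funext x
  rw [Pi.smul_apply, smul_eq_mul]
  rcases trichotomy x with rfl | ⟨j, rfl⟩ | h
  · rw [Wst_other _ (fun j => (rq_ne_zero j).symm), h0, mul_zero]
  · rw [Wst_rq, mul_assoc, mul_inv_cancel₀ hs, mul_one]
    exact (hr j.1 j.isLt).symm
  · rw [Wst_other x (two_ne_rq x h), htwo x h, mul_zero]

lemma embed_herm {d : Fin n → ℕ} (K : Finset (Fin n)) (B : Matrix (SubIdx d K) (SubIdx d K) ℂ)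
    (hB : B.IsHermitian) : (embed K B).IsHermitian := by
  ext x y
  rw [Matrix.conjTranspose_apply]
  unfold embed
  by_cases h : corestrict K x = corestrict K y
  · rw [if_pos h, if_pos h.symm]; exact hB.apply _ _
  · rw [if_neg h, if_neg (fun h' => h h'.symm), star_zero]

end WProof

/-- For every `n ≥ 3` there is a nearest-neighbour Hamiltonian
`H = ∑ᵢ H_{i,i+1}` on the chain of `n` qubits whose unique ground state is the
W state `|W(n)⟩`. -/
theorem w_state_unique_ground_state (n : ℕ) (hn : 3 ≤ n) :
    ∃ (B : ∀ i : Fin (n - 1),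
        Matrix (SubIdx (dq n) (pairK n i)) (SubIdx (dq n) (pairK n i)) ℂ)
      (E : ℝ), (∀ i, (B i).IsHermitian) ∧
      IsGroundStateSpace (∑ i, embed (pairK n i) (B i)) E
        (Submodule.span ℂ {Wst n}) := by
  obtain ⟨C, hC⟩ := exists_C hn
  refine ⟨fun i => locB C i, -1, fun i => locB_herm C i, ?_⟩
  have hpsd : ((∑ i, embed (pairK n i) (locB C i)) - ((-1 : ℝ) : ℂ) • 1).PosSemidef := by
    refine Matrix.PosSemidef.of_dotProduct_mulVec_nonneg ?_ ?_
    · refine Matrix.IsHermitian.sub ?_ ?_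
      · rw [Matrix.IsHermitian, Matrix.conjTranspose_sum]
        exact Finset.sum_congr rfl fun i _ => embed_herm _ _ (locB_herm C i)
      · rw [Matrix.IsHermitian, Matrix.conjTranspose_smul, Matrix.conjTranspose_one]
        simp
    · intro v
      rw [form_eq]
      have := hC v
      have := Qf_nonneg v
      rw [Complex.zero_le_real]
      nlinarith [sq_nonneg ‖v 0‖]
  refine ⟨hpsd, fun v => ?_⟩
  have hker : (∑ i, embed (pairK n i) (locB C i)).mulVec v = ((-1 : ℝ) : ℂ) • v ↔
      C * Qf v - ∑ x, (Nf x - 1) * ‖v x‖ ^ 2 = 0 := by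
    rw [← Complex.ofReal_eq_zero, ← form_eq, hpsd.dotProduct_mulVec_zero_iff, Matrix.sub_mulVec,
      Matrix.smul_mulVec, Matrix.one_mulVec, sub_eq_zero]
  constructor
  · have hW : (∑ i, embed (pairK n i) (locB C i)).mulVec (Wst n) = ((-1 : ℝ) : ℂ) • Wst n := by
      have h0 : star (Wst n) ⬝ᵥ ((∑ i, embed (pairK n i) (locB C i))
          - ((-1 : ℝ) : ℂ) • 1).mulVec (Wst n) = 0 := by
        rw [form_eq, Qf_Wst, Nsum_Wst hn]; simp
      rwa [hpsd.dotProduct_mulVec_zero_iff, Matrix.sub_mulVec,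
        Matrix.smul_mulVec, Matrix.one_mulVec, sub_eq_zero] at h0
    intro hv
    obtain ⟨a, rfl⟩ := Submodule.mem_span_singleton.1 hv
    rw [Matrix.mulVec_smul, hW, smul_comm]
  · intro hv
    have h := hker.1 hv
    have h1 := hC v
    have h2 := Qf_nonneg v
    have h3 := sq_nonneg ‖v 0‖
    refine eq_of_Q hn v (by linarith) ?_
    have : ‖v 0‖ ^ 2 = 0 := by linarith
    exact norm_eq_zero.1 (pow_eq_zero_iff (two_ne_zero) |>.1 this)

end Paper
end
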